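/- arXiv:2502.20800 — 3 statements merged into one kernel-verified Lean document; each statement's English description precedes it below -/
import Mathlib

section
/- Let A₆ be the alternating group of degree 6, S = ⟨(3,4)(5,6), (1,6,4)(2,3,5)⟩ ≤ A₆ (isomorphic to the symmetric group of degree 4) and A = ⟨(1,5)(4,6), (1,3,2)(4,5,6)⟩ ≤ A₆ (isomorphic to the alternating group of degree 5). Let ε and ε′ be the trivial characters of S and A respectively. Then Ind_S^{A₆}(ε) − Ind_A^{A₆}(ε′) equals the irreducible character of A₆ of degree 9. -/
open scoped Classical

/-- Induction of a class function `ψ` on a subgroup `H` of `G` to `G`. -/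
noncomputable def indChar {G : Type} [Group G] [Fintype G] {K : Type} [Field K]
    (H : Subgroup G) (ψ : H → K) (g : G) : K :=
  (Fintype.card H : K)⁻¹ * ∑ x : G, if h : x⁻¹ * g * x ∈ H then ψ ⟨x⁻¹ * g * x, h⟩ else 0

/-- The alternating group on the six letters `{1,…,6} ⊆ Fin 7`. -/
def A6 : Subgroup (Equiv.Perm (Fin 7)) :=
  alternatingGroup (Fin 7) ⊓ MulAction.stabilizer (Equiv.Perm (Fin 7)) (0 : Fin 7)

namespace A6char

open Equiv

/-- The `i`-th octal digit of `c`. -/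
def dig (c i : ℕ) : ℕ := c / 8 ^ i % 8

/-- Product of two permutations on the level of codes. -/
def mulc (p q : ℕ) : ℕ :=
  dig p (dig q 0) + 8 * dig p (dig q 1) + 64 * dig p (dig q 2) + 512 * dig p (dig q 3) +
    4096 * dig p (dig q 4) + 32768 * dig p (dig q 5) + 262144 * dig p (dig q 6)

/-- Inverse of a permutation on the level of codes. -/
def invc (p : ℕ) : ℕ :=
  8 ^ dig p 1 + 2 * 8 ^ dig p 2 + 3 * 8 ^ dig p 3 + 4 * 8 ^ dig p 4 + 5 * 8 ^ dig p 5 +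
    6 * 8 ^ dig p 6

/-- Power on the level of codes. -/
def powc (p : ℕ) : ℕ → ℕ
  | 0 => 1754760
  | n + 1 => mulc (powc p n) p

/-- The code of a permutation: its values are the octal digits. -/
def code (σ : Perm (Fin 7)) : ℕ :=
  (σ 0).val + 8 * (σ 1).val + 64 * (σ 2).val + 512 * (σ 3).val +
    4096 * (σ 4).val + 32768 * (σ 5).val + 262144 * (σ 6).val

theorem dig_code (σ : Perm (Fin 7)) (i : Fin 7) : dig (code σ) i.val = (σ i).val := by
  have h0 := (σ 0).isLt
  have h1 := (σ 1).isLt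
  have h2 := (σ 2).isLt
  have h3 := (σ 3).isLt
  have h4 := (σ 4).isLt
  have h5 := (σ 5).isLt
  have h6 := (σ 6).isLt
  fin_cases i <;> simp [dig, code] <;> omega

theorem code_inj {σ τ : Perm (Fin 7)} (h : code σ = code τ) : σ = τ := by
  ext i
  rw [← dig_code, h, dig_code]

theorem code_mul (σ τ : Perm (Fin 7)) : code (σ * τ) = mulc (code σ) (code τ) := by
  have h (i : Fin 7) : dig (code σ) (dig (code τ) i.val) = ((σ * τ) i).val := by
    rw [dig_code, dig_code]; rfl
  have h0 := h 0
  have h1 := h 1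
  have h2 := h 2
  have h3 := h 3
  have h4 := h 4
  have h5 := h 5
  have h6 := h 6
  simp only [Fin.val_zero, Fin.val_one, Fin.val_two, Fin.isValue] at h0 h1 h2
  change dig _ (dig _ 3) = _ at h3
  change dig _ (dig _ 4) = _ at h4
  change dig _ (dig _ 5) = _ at h5
  change dig _ (dig _ 6) = _ at h6
  rw [mulc, h0, h1, h2, h3, h4, h5, h6, code]

theorem code_eq_sum (σ : Perm (Fin 7)) : code σ = ∑ i : Fin 7, (σ i).val * 8 ^ i.val := by
  rw [Fin.sum_univ_seven, code]
  simp
  ring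

theorem code_inv (σ : Perm (Fin 7)) : code σ⁻¹ = invc (code σ) := by
  rw [code_eq_sum, ← Equiv.sum_comp σ]
  simp only [Perm.inv_def, Equiv.symm_apply_apply]
  simp only [← dig_code]
  rw [Fin.sum_univ_seven, invc]
  simp

theorem code_one : code 1 = 1754760 := by decide

theorem code_pow (σ : Perm (Fin 7)) (n : ℕ) : code (σ ^ n) = powc (code σ) n := by
  induction n with
  | zero => exact code_one
  | succ n ih => rw [pow_succ, code_mul, ih, powc]

/-- The first of four permutations used to form words. -/
def wP : Perm (Fin 7) := c[2, 3, 4, 5, 6]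
def wQ : Perm (Fin 7) := c[1, 4, 6, 5, 3]
def wR : Perm (Fin 7) := c[1, 2, 5, 3, 6]
def wS : Perm (Fin 7) := c[2, 6, 5, 4, 3]

/-- Representatives of the seven conjugacy classes of `A6`. -/
def rp : ℕ → Perm (Fin 7)
  | 0 => 1
  | 1 => c[1, 2] * c[3, 4]
  | 2 => c[1, 2, 3]
  | 3 => c[1, 2, 3] * c[4, 5, 6]
  | 4 => c[1, 2, 3, 4] * c[5, 6]
  | 5 => c[1, 2, 3, 4, 5]
  | _ => c[1, 3, 5, 2, 4]

/-- Codes of the representatives. -/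
def rpc : ℕ → ℕ
  | 0 => 1754760
  | 1 => 1751120
  | 2 => 1753808
  | 3 => 1266384
  | 4 => 1513680
  | 5 => 1628368
  | _ => 1645336

theorem code_rp (j : ℕ) : code (rp j) = rpc j := by
  match j with
  | 0 => exact code_one
  | 1 => decide +kernel
  | 2 => decide +kernel
  | 3 => decide +kernel
  | 4 => decide +kernel
  | 5 => decide +kernel
  | n + 6 => change code (rp 6) = rpc 6; decide +kernel

theorem mem_A6 {σ : Perm (Fin 7)} : σ ∈ A6 ↔ Perm.sign σ = 1 ∧ σ 0 = 0 := by
  simp [A6, Subgroup.mem_inf, Perm.mem_alternatingGroup, MulAction.mem_stabilizer_iff]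

theorem rp_mem (j : ℕ) : rp j ∈ A6 := by
  rw [mem_A6]
  match j with
  | 0 => decide +kernel
  | 1 => decide +kernel
  | 2 => decide +kernel
  | 3 => decide +kernel
  | 4 => decide +kernel
  | 5 => decide +kernel
  | n + 6 => change Perm.sign (rp 6) = 1 ∧ rp 6 0 = 0; decide +kernel

theorem wP_mem : wP ∈ A6 := by rw [mem_A6]; decide +kernel
theorem wQ_mem : wQ ∈ A6 := by rw [mem_A6]; decide +kernel
theorem wR_mem : wR ∈ A6 := by rw [mem_A6]; decide +kernel
theorem wS_mem : wS ∈ A6 := by rw [mem_A6]; decide +kernel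

/-- The class representatives as elements of `A6`. -/
def rep (j : ℕ) : A6 := ⟨rp j, rp_mem j⟩

/-- The `n`-th word. -/
def kelt (n : ℕ) : A6 :=
  (⟨wP, wP_mem⟩ ^ (n % 5) * ⟨wQ, wQ_mem⟩ ^ (n / 5 % 5)) *
    (⟨wR, wR_mem⟩ ^ (n / 25 % 5) * ⟨wS, wS_mem⟩ ^ (n / 125))

/-- The code of the `n`-th word. -/
def kcode (n : ℕ) : ℕ :=
  mulc (mulc (powc 743624 (n % 5)) (powc 1434272 (n / 5 % 5)))
    (mulc (powc 380240 (n / 25 % 5)) (powc 1455496 (n / 125)))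

theorem code_kelt (n : ℕ) : code (kelt n) = kcode n := by
  have h0 : code wP = 743624 := by decide +kernel
  have h1 : code wQ = 1434272 := by decide +kernel
  have h2 : code wR = 380240 := by decide +kernel
  have h3 : code wS = 1455496 := by decide +kernel
  simp only [kelt, kcode, Subgroup.coe_mul, Subgroup.coe_pow, code_mul, code_pow, h0, h1, h2, h3]

/-- The conjugate of a representative encoded by `t`. -/
def gelt (t : ℕ) : A6 := kelt (t / 8) * rep (t % 8) * (kelt (t / 8))⁻¹

/-- Its code. -/
def gcode (t : ℕ) : ℕ := mulc (mulc (kcode (t / 8)) (rpc (t % 8))) (invc (kcode (t / 8)))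

theorem code_gelt (t : ℕ) : code (gelt t) = gcode t := by
  simp only [gelt, gcode, Subgroup.coe_mul, Subgroup.coe_inv, code_mul, code_inv, code_kelt]
  rw [← code_rp]; rfl

/-- Words describing all elements of `A6` as conjugates of representatives. -/
def tabW : List ℕ :=
  [492, 140, 172, 345, 1285, 77, 1318, 108, 75, 22, 1076, 91, 228, 1340, 76, 358, 1425, 950,
   3308, 227, 1173, 339, 341, 316, 805, 556, 179, 684, 315, 62, 948, 801, 428, 340, 3285, 838,
   41, 1198, 102, 957, 169, 173, 33, 314, 74, 1133, 338, 3302, 3141, 27, 1428, 139, 3140, 1150,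
   3150, 26, 93, 20, 198, 13, 420, 332, 548, 25, 3294, 94, 85, 12, 19, 69, 100, 83, 3124, 1060,
   212, 1189, 705, 3149, 404, 35, 158, 51, 134, 1436, 1182, 516, 211, 924, 147, 213, 36, 81,
   3148, 3284, 1158, 149, 193, 37, 325, 1294, 97, 3158, 817, 34, 210, 174, 82, 101, 3286, 11,
   92, 203, 28, 141, 29, 202, 166, 84, 21, 2166, 3300, 308, 68, 165, 1125, 73, 131, 190, 1420,
   132, 67, 14, 1412, 124, 300, 814, 30, 121, 107, 125, 1044, 292, 99, 3045, 299, 1309, 1324,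
   355, 206, 180, 356, 500, 689, 1149, 230, 148, 822, 1134, 1409, 3301, 45, 129, 354, 130, 353,
   38, 1293, 98, 540, 117, 115, 1052, 150, 43, 357, 1286, 114, 3318, 133, 116, 942, 331, 220,
   716, 3317, 171, 3132, 3142, 3133, 164, 337, 1068, 197, 59, 60, 1356, 222, 347, 532, 349, 142,
   1404, 153, 284, 163, 196, 934, 195, 44, 2165, 118, 237, 236, 52, 1348, 145, 46, 58, 1197,
   3157, 194, 958, 821, 326, 170, 57, 713, 1433, 412, 86, 61, 204, 1181, 126, 1174, 205, 3316,
   3, 235, 234, 350, 219, 1332, 307, 940, 837, 949, 306, 1190, 484, 1317, 1310, 1157, 123, 3292,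
   291, 348, 238, 1126, 122, 3293, 156, 806, 157, 708, 3134, 323, 188, 229, 187, 78, 813, 186,
   189, 214, 524, 932, 941, 342, 700, 70, 221, 933, 3046, 692, 155, 283, 154, 324, 17, 4, 3156,
   697, 436, 508, 956, 113, 185, 89, 809, 1417, 1165, 333, 54, 833, 830, 161, 66, 330, 1142, 18,
   5, 65, 182, 6, 1301, 681, 1141, 1401, 346, 90, 109, 106, 3310, 3309, 3125, 329, 926, 110,
   137, 50, 162, 49, 53, 1166, 226, 829, 298, 1302, 3126, 178, 181, 334, 925, 146, 9, 105, 177,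
   825, 322, 10, 321, 42, 218, 290, 138, 1, 2, 282, 0]

/-- Codes with class labels. -/
def tabC : List ℕ :=
  [2739524, 2742660, 2747140, 2767745, 2776261, 2778949, 2800902, 2803588, 2812099, 2832710,
   2837188, 2840323, 2968452, 2972932, 2976068, 3026246, 3036545, 3041926, 3058052, 3067011,
   3073285, 3091203, 3097925, 3102852, 3226949, 3233668, 3238595, 3255172, 3267715, 3269958,
   3321028, 3323265, 3335812, 3352388, 3357317, 3364038, 3488129, 3493062, 3499782, 3517701,
   3523969, 3532933, 3549057, 3554434, 3564738, 3614917, 3618050, 3622534, 3750661, 3753795,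
   3758276, 3778883, 3787396, 3790086, 3812038, 3814722, 3823237, 3843844, 3848326, 3851461,
   4574084, 4578564, 4581700, 4603201, 4609926, 4614854, 4635013, 4639940, 4646659, 4668165,
   4671300, 4675779, 5033284, 5036420, 5040900, 5118853, 5135425, 5137221, 5152004, 5161859,
   5171270, 5183811, 5196358, 5198596, 5290886, 5299396, 5302083, 5348676, 5362563, 5368389,
   5412740, 5422145, 5432004, 5446340, 5452614, 5461573, 5553409, 5556101, 5564613, 5609862,
   5622849, 5628678, 5643457, 5649282, 5662274, 5707526, 5716034, 5718725, 5814598, 5819075,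
   5822212, 5872387, 5882692, 5888069, 5904197, 5913154, 5919430, 5937348, 5944069, 5948998,
   6638916, 6642052, 6646532, 6695813, 6708357, 6710593, 6728963, 6735238, 6744196, 6760772,
   6769283, 6771974, 6867844, 6872324, 6875460, 6954310, 6968198, 6974017, 6986115, 6999109,
   7004932, 7019268, 7029571, 7034949, 7384387, 7394693, 7400068, 7412611, 7429190, 7430980,
   7511172, 7512964, 7529537, 7542085, 7547462, 7557764, 7645574, 7654534, 7660801, 7675141,
   7684997, 7694401, 7738754, 7744578, 7758465, 7805062, 7807749, 7816258, 7908100, 7914821,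
   7919747, 7936324, 7948870, 7951107, 8002181, 8004422, 8016962, 8033542, 8038469, 8045188,
   8731526, 8740035, 8742724, 8760644, 8770949, 8776323, 8824708, 8830086, 8840389, 8858308,
   8860993, 8869508, 8961349, 8968067, 8972996, 9018244, 9034822, 9036611, 9084100, 9089925,
   9102918, 9115460, 9124417, 9130692, 9218947, 9231492, 9233734, 9248067, 9261956, 9267781,
   9344390, 9350213, 9364100, 9378436, 9380676, 9393217, 9743558, 9745794, 9758341, 9770885,
   9780290, 9790150, 9804933, 9806726, 9823298, 9901249, 9905729, 9908865, 10004292, 10009222,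
   10015941, 10033860, 10040133, 10049094, 10065222, 10070597, 10080900, 10131075, 10134211,
   10138690, 10829062, 10831747, 10840260, 10856835, 10865796, 10872069, 10890437, 10892674,
   10905222, 10954500, 10958981, 10962118, 11057541, 11062467, 11069188, 11115779, 11125636,
   11135046, 11147142, 11156546, 11166405, 11212996, 11219718, 11224645, 11316484, 11322758,
   11331715, 11344260, 11357253, 11363075, 11410566, 11412357, 11428930, 11474181, 11479110,
   11485828, 11577220, 11582597, 11592902, 11607236, 11613062, 11626053, 11638149, 11643974,
   11657860, 11736707, 11739843, 11744322, 12101828, 12104961, 12109444, 12130052, 12138561,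
   12141252, 12163204, 12165892, 12174401, 12195009, 12199489, 12202625, 12925249, 12929733,
   12932869, 12954374, 12961089, 12966022, 12986177, 12991106, 12997826, 13019334, 13022466,
   13026949, 13155073, 13158214, 13162694, 13211973, 13224513, 13226757, 13245121, 13251394,
   13260354, 13276933, 13285442, 13288134, 13412677, 13421189, 13423873, 13441798, 13452102,
   13457473, 13505858, 13511234, 13521537, 13539461, 13542150, 13550658, 13675205, 13677890,
   13686406, 13702982, 13711938, 13718213, 13736582, 13738821, 13751362, 13800641, 13805121,
   13808257, 13936385, 13940866, 13944002, 13965505, 13972226, 13977154, 13997314, 14002242,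
   14008961, 14030466, 14033602, 14038080]

def lstS : List ℕ :=
  [386400, 415128, 443632, 472360, 647976, 676592, 705432, 734048, 830816, 859432, 941192,
   969808, 1092504, 1121008, 1174152, 1260112, 1353968, 1382808, 1435728, 1521800, 1615656,
   1644384, 1726032, 1754760]

def lstA : List ℕ :=
  [345968, 351512, 383376, 386400, 403368, 420504, 437472, 440496, 472360, 477904, 576856,
   579376, 641928, 647976, 662760, 670320, 694176, 714840, 734048, 743624, 841120, 846160,
   869288, 879368, 926576, 941192, 955696, 969808, 989352, 993888, 1092504, 1107624, 1121008,
   1129576, 1158472, 1168048, 1225616, 1238216, 1251152, 1266776, 1353968, 1359008, 1382808,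
   1402464, 1416464, 1426544, 1455496, 1467088, 1517320, 1524376, 1620752, 1623272, 1653064,
   1659616, 1677984, 1681512, 1709400, 1726032, 1745688, 1754760]

def lstC3 : List ℕ :=
  [1753808, 1754200, 1754760]

def lstC5 : List ℕ :=
  [1628368, 1645336, 1680224, 1717352, 1754760]

def lstS3 : List ℕ :=
  [1725080, 1725640, 1726032, 1753808, 1754200, 1754760]

def lstD8 : List ℕ :=
  [1513680, 1517320, 1520736, 1524376, 1742048, 1745688, 1751120, 1754760]

theorem tab_eq : tabW.map (fun t => gcode t * 8 + t % 8) = tabC := by decide +kernel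

/-- Boolean test for a strictly increasing list. -/
def incr : List ℕ → Bool
  | [] => true
  | [_] => true
  | a :: b :: l => Nat.blt a b && incr (b :: l)

theorem incr_sound : ∀ l : List ℕ, incr l = true → l.IsChain (· < ·)
  | [], _ => by simp
  | [_], _ => by simp
  | a :: b :: l, h => by
    simp only [incr, Bool.and_eq_true, Nat.blt_eq] at h
    exact List.IsChain.cons_cons h.1 (incr_sound _ h.2)

theorem incr_tab : incr (tabC.map (· / 8)) = true := by decide +kernel

theorem nodup_tab : (tabC.map (· / 8)).Nodup :=
  ((incr_sound _ incr_tab).pairwise).imp (fun h => ne_of_lt h)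

section RepTheory

open CategoryTheory Module

variable {G : Type} [Group G]

/-- A simple object has no proper nonzero invariant submodules. -/
theorem simple_submodule (V : FDRep ℚ G) (hV : Simple V) (W : Submodule ℚ V)
    (hW : ∀ g : G, ∀ w ∈ W, V.ρ g w ∈ W) : W = ⊥ ∨ W = ⊤ := by
  let σ : Representation ℚ G W :=
    { toFun := fun g => (V.ρ g).restrict (hW g)
      map_one' := by ext; simp
      map_mul' := fun x y => by ext; simp }
  let f : FDRep.of σ ⟶ V :=
    ⟨InducedCategory.homMk (ModuleCat.ofHom W.subtype), fun g => by
      ext x; rfl⟩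
  have hf (x : W) : f.hom.hom.hom x = (x : V) := rfl
  have : Mono f := by
    apply (Action.forget (FGModuleCat ℚ) G).mono_of_mono_map
    apply (forget₂ (FGModuleCat ℚ) (ModuleCat ℚ)).mono_of_mono_map
    rw [ModuleCat.mono_iff_injective]
    exact Subtype.val_injective
  by_cases h0 : f = 0
  · left
    rw [Submodule.eq_bot_iff]
    intro x hx
    have := hf ⟨x, hx⟩
    rw [h0] at this
    exact this.symm
  · right
    have : IsIso f := isIso_of_mono_of_nonzero h0
    have e := (FDRep.isoToLinearEquiv (asIso f)).finrank_eq
    exact Submodule.eq_top_of_finrank_eq e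

theorem char_sum_subgroup [Fintype G] (V : FDRep ℚ G) (H : Subgroup G) :
    ∑ g : G, (if g ∈ H then V.character g else 0) =
      (Nat.card H : ℚ) *
        (finrank ℚ (Representation.invariants (V.ρ.comp H.subtype)) : ℚ) := by
  have hne : (Nat.card H : ℚ) ≠ 0 := by
    exact_mod_cast Nat.card_pos.ne'
  have : Invertible (Nat.card H : ℚ) := invertibleOfNonzero hne
  have h := Representation.card_inv_mul_sum_char_eq_finrank (V.ρ.comp H.subtype)
  rw [← h, mul_inv_cancel_left₀ hne]
  rw [← Finset.sum_filter]
  symm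
  apply Finset.sum_bij (fun (x : H) _ => (x : G))
  · intro a _; simp
  · intro a _ b _ h; exact Subtype.ext h
  · intro b hb; exact ⟨⟨b, (Finset.mem_filter.1 hb).2⟩, Finset.mem_univ _, rfl⟩
  · intro a _; rfl

theorem invariants_zero [Finite G] (V : FDRep ℚ G) (hV : Simple V) (H : Subgroup G)
    (hH : H.index < finrank ℚ V) :
    finrank ℚ (Representation.invariants (V.ρ.comp H.subtype)) = 0 := by
  rw [Submodule.finrank_eq_zero, Submodule.eq_bot_iff]
  intro v hv
  have hv' : ∀ h ∈ H, V.ρ h v = v := fun h hh => hv ⟨h, hh⟩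
  by_contra hne
  let φ : G ⧸ H → V := fun q => V.ρ q.out v
  have hφ (g : G) : V.ρ g v = φ (QuotientGroup.mk g) := by
    obtain ⟨h, hh⟩ := QuotientGroup.mk_out_eq_mul H g
    simp only [φ]
    rw [hh, map_mul, Module.End.mul_apply, hv' _ h.2]
  let W : Submodule ℚ V := Submodule.span ℚ (Set.range φ)
  have hW : ∀ g : G, ∀ w ∈ W, V.ρ g w ∈ W := by
    intro g w hw
    induction hw using Submodule.span_induction with
    | mem x hx =>
      obtain ⟨q, rfl⟩ := hx
      apply Submodule.subset_span
      refine ⟨QuotientGroup.mk (g * q.out), ?_⟩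
      rw [← hφ, map_mul]; rfl
    | zero => simp
    | add x y _ _ hx hy => rw [map_add]; exact W.add_mem hx hy
    | smul a x _ hx => rw [map_smul]; exact W.smul_mem a hx
  have : Fintype (G ⧸ H) := Fintype.ofFinite _
  have hle : finrank ℚ W ≤ H.index := by
    rw [Subgroup.index, Nat.card_eq_fintype_card]
    exact finrank_range_le_card φ
  have hvW : v ∈ W := Submodule.subset_span ⟨QuotientGroup.mk 1, by rw [← hφ]; simp⟩
  rcases simple_submodule V hV W hW with h | h
  · rw [h] at hvW; exact hne hvW
  · rw [h, finrank_top] at hle; omega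

theorem char_norm [Fintype G] (V : FDRep ℚ G) (hV : Simple V) :
    ∃ d : ℕ, d ≤ finrank ℚ V ∧
      ∑ g : G, V.character g * V.character g⁻¹ = (Nat.card G : ℚ) * d := by
  have hne : (Nat.card G : ℚ) ≠ 0 := by
    exact_mod_cast Nat.card_pos.ne'
  have : Invertible (Nat.card G : ℚ) := invertibleOfNonzero hne
  have h := Representation.card_inv_mul_sum_char_mul_char_eq_finrank V.ρ V.ρ
  refine ⟨finrank ℚ (Representation.IntertwiningMap V.ρ V.ρ), ?_, ?_⟩
  · by_cases hz : ∃ v : V, v ≠ 0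
    · obtain ⟨v, hv⟩ := hz
      let ev : Representation.IntertwiningMap V.ρ V.ρ →ₗ[ℚ] V :=
        { toFun := fun f => f v
          map_add' := fun _ _ => rfl
          map_smul' := fun _ _ => rfl }
      apply LinearMap.finrank_le_finrank_of_injective (f := ev)
      rw [injective_iff_map_eq_zero]
      intro f hf
      have hf' : f.toLinearMap v = 0 := hf
      have hk := simple_submodule V hV (LinearMap.ker f.toLinearMap) (by
        intro g w hw
        rw [LinearMap.mem_ker] at hw ⊢
        have := LinearMap.congr_fun (f.isIntertwining' g) w
        simp only [LinearMap.comp_apply] at this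
        rw [this, hw, map_zero])
      rcases hk with hk | hk
      · exact absurd (by rw [← LinearMap.mem_ker, hk] at hf'; exact hf') hv
      · rw [LinearMap.ker_eq_top] at hk
        ext x
        exact LinearMap.congr_fun hk x
    · push Not at hz
      have : Subsingleton V := ⟨fun a b => by rw [hz a, hz b]⟩
      have : Subsingleton (Representation.IntertwiningMap V.ρ V.ρ) :=
        ⟨fun a b => by ext x; exact Subsingleton.elim _ _⟩
      rw [finrank_zero_of_subsingleton]; exact Nat.zero_le _
  · rw [← h, mul_inv_cancel_left₀ hne]; rfl

end RepTheory

theorem nodup_gelt : (tabW.map gelt).Nodup := by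
  have h := nodup_tab
  rw [← tab_eq, List.map_map] at h
  have h2 : tabW.map ((· / 8) ∘ fun t => gcode t * 8 + t % 8) =
      (tabW.map gelt).map (fun g : A6 => code g) := by
    rw [List.map_map]
    apply List.map_congr_left
    intro t _
    simp only [Function.comp, code_gelt]
    omega
  rw [h2] at h
  exact List.Nodup.of_map _ h

theorem card_A6_le : Nat.card A6 ≤ 360 := by
  let St := MulAction.stabilizer (Perm (Fin 7)) (0 : Fin 7)
  have h1 : Nat.card St = 720 := by
    have h := St.card_mul_index
    rw [MulAction.index_stabilizer_of_transitive] at h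
    simp only [Nat.card_eq_fintype_card, Fintype.card_perm, Fintype.card_fin] at h
    rw [Nat.card_eq_fintype_card]
    have : Nat.factorial 7 = 5040 := rfl
    omega
  have hs : swap (1 : Fin 7) 2 ∈ St := by
    rw [MulAction.mem_stabilizer_iff]; decide
  let φ : A6 × Bool → St := fun x =>
    if x.2 then ⟨x.1, x.1.2.2⟩ * ⟨_, hs⟩ else ⟨x.1, x.1.2.2⟩
  have hsg (g : A6) : Perm.sign (g : Perm (Fin 7)) = 1 := (mem_A6.1 g.2).1
  have hφ : Function.Injective φ := by
    have hd : Perm.sign (swap (1 : Fin 7) 2) = -1 := Perm.sign_swap (by decide)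
    rintro ⟨a, b⟩ ⟨c, d⟩ h
    have h' := congrArg Subtype.val h
    have hsn := congrArg Perm.sign h'
    cases b <;> cases d <;> simp [φ, hsg, hd] at h' hsn ⊢
    all_goals exact h'
  have := Nat.card_le_card_of_injective φ hφ
  rw [h1, Nat.card_prod] at this
  simp at this
  rw [Nat.card_eq_fintype_card]
  omega

theorem sum_tab [Fintype A6] (F : A6 → ℚ) :
    ∑ g : A6, F g = (tabW.map (fun t => F (gelt t))).sum := by
  have hl : (tabW.map gelt).length = 360 := by rw [List.length_map]; decide +kernel
  have hu : (Finset.univ : Finset A6) = (tabW.map gelt).toFinset := by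
    symm
    apply Finset.eq_univ_of_card
    apply le_antisymm (Finset.card_le_univ _)
    rw [List.toFinset_card_of_nodup nodup_gelt, hl, ← Nat.card_eq_fintype_card]
    exact card_A6_le
  rw [hu, List.sum_toFinset F nodup_gelt, List.map_map]
  rfl

theorem exists_gelt (g : A6) : ∃ t, gelt t = g := by
  have : Fintype A6 := Fintype.ofFinite _
  by_contra h
  push Not at h
  have h1 := sum_tab (fun x => if x = g then 1 else 0)
  rw [Finset.sum_ite_eq' Finset.univ g, if_pos (Finset.mem_univ _)] at h1
  simp [h] at h1

/-- Number of elements of class `j` whose code satisfies `pr`. -/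
def cnt (pr : ℕ → Bool) (j : ℕ) : ℕ := tabC.countP (fun u => pr (u / 8) && Nat.beq (u % 8) j)

theorem count_list (pr : ℕ → Bool) (x : ℕ → ℚ) (l : List ℕ) :
    (l.map (fun u => if pr (u / 8) then x (u % 8) else 0)).sum =
      ∑ j ∈ Finset.range 8, (l.countP (fun u => pr (u / 8) && Nat.beq (u % 8) j) : ℚ) * x j := by
  induction l with
  | nil => simp
  | cons a l ih =>
    rw [List.map_cons, List.sum_cons, ih]
    simp only [List.countP_cons, Nat.cast_add, add_mul, Finset.sum_add_distrib]
    rw [add_comm]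
    congr 1
    have ha : a % 8 ∈ Finset.range 8 := Finset.mem_range.2 (Nat.mod_lt _ (by norm_num))
    rw [Finset.sum_eq_single_of_mem _ ha]
    · by_cases hp : pr (a / 8) <;> simp [hp]
    · intro j _ hj
      have : Nat.beq (a % 8) j = false := by
        rw [Bool.eq_false_iff]
        intro hh
        exact hj (Nat.eq_of_beq_eq_true hh).symm
      simp [this]

theorem sum_pr [Fintype A6] (F : A6 → ℚ) (hF : ∀ g k : A6, F (k * g * k⁻¹) = F g)
    (pr : ℕ → Bool) {n0 n1 n2 n3 n4 n5 n6 : ℕ}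
    (hc : (List.range 8).map (cnt pr) = [n0, n1, n2, n3, n4, n5, n6, 0]) :
    ∑ g : A6, (if pr (code g) then F g else 0) =
      n0 * F (rep 0) + n1 * F (rep 1) + n2 * F (rep 2) + n3 * F (rep 3) + n4 * F (rep 4) +
        n5 * F (rep 5) + n6 * F (rep 6) := by
  rw [sum_tab]
  have h : tabW.map (fun t => if pr (code (gelt t)) then F (gelt t) else 0) =
      tabC.map (fun u => if pr (u / 8) then F (rep (u % 8)) else 0) := by
    rw [← tab_eq, List.map_map]
    apply List.map_congr_left
    intro t _
    have h1 : (gcode t * 8 + t % 8) / 8 = gcode t := by omega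
    have h2 : (gcode t * 8 + t % 8) % 8 = t % 8 := by omega
    have h3 : F (gelt t) = F (rep (t % 8)) := hF _ _
    simp only [Function.comp, code_gelt, h1, h2, h3]
  rw [h, count_list pr (fun j => F (rep j)) tabC]
  have hr : List.range 8 = [0, 1, 2, 3, 4, 5, 6, 7] := rfl
  rw [hr] at hc
  simp only [List.map_cons, List.map_nil, List.cons.injEq, cnt] at hc
  obtain ⟨h0, h1, h2, h3, h4, h5, h6, h7, -⟩ := hc
  simp only [Finset.sum_range_succ, Finset.sum_range_zero, h0, h1, h2, h3, h4, h5, h6, h7]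
  push_cast
  ring

theorem count_pr [Fintype A6] (pr : ℕ → Bool) :
    ∑ g : A6, (if pr (code g) then (1 : ℚ) else 0) = tabC.countP (fun u => pr (u / 8)) := by
  rw [sum_tab]
  have h : tabW.map (fun t => if pr (code (gelt t)) then (1 : ℚ) else 0) =
      tabC.map (fun u => if pr (u / 8) then (1 : ℚ) else 0) := by
    rw [← tab_eq, List.map_map]
    apply List.map_congr_left
    intro t _
    have h1 : (gcode t * 8 + t % 8) / 8 = gcode t := by omega
    simp only [Function.comp, code_gelt, h1]
  rw [h]
  induction tabC with
  | nil => simp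
  | cons a l ih =>
    rw [List.map_cons, List.sum_cons, ih, List.countP_cons]
    by_cases hp : pr (a / 8) <;> simp [hp, add_comm]

theorem card_sub [Fintype A6] (H : Subgroup A6) :
    ∑ g : A6, (if g ∈ H then (1 : ℚ) else 0) = Nat.card H := by
  rw [← Finset.sum_filter, Finset.sum_const, nsmul_eq_mul, mul_one, Nat.card_eq_fintype_card,
    Fintype.card_subtype]

theorem sub_char (V : FDRep ℚ A6) (H : Subgroup A6) (pr : ℕ → Bool)
    (hpr : ∀ g : A6, g ∈ H ↔ pr (code g) = true) {n0 n1 n2 n3 n4 n5 n6 : ℕ}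
    (hc : (List.range 8).map (cnt pr) = [n0, n1, n2, n3, n4, n5, n6, 0]) :
    Nat.card H = n0 + n1 + n2 + n3 + n4 + n5 + n6 ∧
    n0 * V.character (rep 0) + n1 * V.character (rep 1) + n2 * V.character (rep 2) +
      n3 * V.character (rep 3) + n4 * V.character (rep 4) + n5 * V.character (rep 5) +
        n6 * V.character (rep 6) = (Nat.card H : ℚ) *
      (Module.finrank ℚ (Representation.invariants (V.ρ.comp H.subtype)) : ℚ) := by
  have : Fintype A6 := Fintype.ofFinite _
  have h1 := card_sub H
  have h2 := char_sum_subgroup V H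
  have hi (F : A6 → ℚ) : ∑ g : A6, (if g ∈ H then F g else 0) =
      ∑ g : A6, (if pr (code g) then F g else 0) := by
    simp only [hpr]
  rw [hi] at h1 h2
  rw [sum_pr (fun _ => 1) (fun _ _ => rfl) pr hc] at h1
  rw [sum_pr V.character (fun g k => V.char_conj g k) pr hc] at h2
  refine ⟨?_, h2⟩
  have : ((n0 + n1 + n2 + n3 + n4 + n5 + n6 : ℕ) : ℚ) = Nat.card H := by
    rw [← h1]; push_cast; ring
  exact_mod_cast this.symm

/-- The subgroup given by a list of codes closed under multiplication and inversion. -/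
def lstSub (B : List ℕ) (h1 : B.contains 1754760 = true)
    (hm : (B.all fun a => B.all fun b => B.contains (mulc a b)) = true)
    (hi : (B.all fun a => B.contains (invc a)) = true) : Subgroup A6 where
  carrier := {g | B.contains (code g) = true}
  one_mem' := by
    change B.contains (code 1) = true
    rw [code_one]; exact h1
  mul_mem' := by
    intro a b ha hb
    simp only [Set.mem_ofPred_eq, Subgroup.coe_mul, code_mul] at ha hb ⊢
    simp only [List.all_eq_true] at hm
    exact hm _ (List.contains_iff_mem.1 ha) _ (List.contains_iff_mem.1 hb)
  inv_mem' := by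
    intro a ha
    simp only [Set.mem_ofPred_eq, Subgroup.coe_inv, code_inv] at ha ⊢
    simp only [List.all_eq_true] at hi
    exact hi _ (List.contains_iff_mem.1 ha)

theorem closure_mem (B : List ℕ) (a b : A6) (ca cb : ℕ) (hca : code a = ca) (hcb : code b = cb)
    (h1 : B.contains 1754760 = true)
    (hm : (B.all fun y => B.contains (mulc ca y) && B.contains (mulc cb y) &&
      B.contains (mulc (invc ca) y) && B.contains (mulc (invc cb) y)) = true)
    (hcard : Nat.card (Subgroup.closure {a, b} : Subgroup A6) =
      tabC.countP (fun u => B.contains (u / 8))) (g : A6) :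
    g ∈ Subgroup.closure {a, b} ↔ B.contains (code g) = true := by
  have hF : Fintype A6 := Fintype.ofFinite _
  simp only [List.all_eq_true, Bool.and_eq_true] at hm
  have hsub : ∀ g ∈ Subgroup.closure {a, b}, B.contains (code g) = true := by
    intro g hg
    induction hg using Subgroup.closure_induction_left with
    | one => rw [Subgroup.coe_one, code_one]; exact h1
    | mul_left x hx y hy ih =>
      have := hm _ (List.contains_iff_mem.1 ih)
      rw [Subgroup.coe_mul, code_mul]
      rcases hx with rfl | rfl
      · rw [hca]; exact this.1.1.1
      · rw [hcb]; exact this.1.1.2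
    | inv_mul_cancel x hx y hy ih =>
      have := hm _ (List.contains_iff_mem.1 ih)
      rw [Subgroup.coe_mul, code_mul, Subgroup.coe_inv, code_inv]
      rcases hx with rfl | rfl
      · rw [hca]; exact this.1.2
      · rw [hcb]; exact this.2
  have hq := count_pr (fun c => B.contains c)
  rw [← hcard, ← card_sub] at hq
  rw [← Finset.sum_filter, ← Finset.sum_filter, Finset.sum_const, Finset.sum_const] at hq
  simp only [nsmul_eq_mul, mul_one, Nat.cast_inj] at hq
  have hs : Finset.univ.filter (fun g : A6 => g ∈ Subgroup.closure {a, b}) =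
      Finset.univ.filter (fun g : A6 => B.contains (code g) = true) := by
    apply Finset.eq_of_subset_of_card_le
    · intro g hg
      rw [Finset.mem_filter] at hg ⊢
      exact ⟨hg.1, hsub g hg.2⟩
    · exact hq.le
  have := Finset.ext_iff.1 hs g
  simpa using this

/-- The subgroup with list of codes `lstC3`. -/
def subC3 : Subgroup A6 :=
  lstSub lstC3 (by decide +kernel) (by decide +kernel) (by decide +kernel)

/-- The subgroup with list of codes `lstC5`. -/
def subC5 : Subgroup A6 :=
  lstSub lstC5 (by decide +kernel) (by decide +kernel) (by decide +kernel)

/-- The subgroup with list of codes `lstS3`. -/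
def subS3 : Subgroup A6 :=
  lstSub lstS3 (by decide +kernel) (by decide +kernel) (by decide +kernel)

/-- The subgroup with list of codes `lstD8`. -/
def subD8 : Subgroup A6 :=
  lstSub lstD8 (by decide +kernel) (by decide +kernel) (by decide +kernel)

theorem all_sum (V : FDRep ℚ A6) (hV : CategoryTheory.Simple V)
    (hdim : Module.finrank ℚ V = 9) (H : Subgroup A6) (hA : Nat.card H = 60)
    (hpr : ∀ g : A6, g ∈ H ↔ lstA.contains (code g) = true) :
    V.character (rep 0) = 9 ∧ V.character (rep 1) = 1 ∧ V.character (rep 2) = 0 ∧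
    V.character (rep 3) = 0 ∧ V.character (rep 4) = 1 ∧ V.character (rep 5) = -1 ∧
    V.character (rep 6) = -1 := by
  have hF : Fintype A6 := Fintype.ofFinite _
  have e0 : V.character (rep 0) = 9 := by
    have : rep 0 = 1 := rfl
    rw [this, FDRep.char_one, hdim]; norm_num
  -- the whole group
  obtain ⟨c1, e1⟩ := sub_char V ⊤ (fun _ => true) (by simp)
    (n0 := 1) (n1 := 45) (n2 := 40) (n3 := 40) (n4 := 90) (n5 := 72) (n6 := 72)
    (by decide +kernel)
  have hG : Nat.card A6 = 360 := by rw [← Subgroup.card_top, c1]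
  rw [invariants_zero V hV ⊤ (by rw [Subgroup.index_top, hdim]; norm_num)] at e1
  have hidx (K : Subgroup A6) (hK : Nat.card K = 60) : K.index < Module.finrank ℚ V := by
    have := K.card_mul_index
    rw [hK, hG] at this
    omega
  -- the stabilizer of the letter 6
  let P : Subgroup A6 :=
    (MulAction.stabilizer (Perm (Fin 7)) (6 : Fin 7)).comap A6.subtype
  obtain ⟨c2, e2⟩ := sub_char V P (fun c => Nat.beq (dig c 6) 6) (by
      intro g
      have h := dig_code g 6
      change dig (code g) 6 = _ at h
      rw [h, Nat.beq_eq]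
      change (g : Perm (Fin 7)) 6 = 6 ↔ _
      rw [Fin.ext_iff]; rfl)
    (n0 := 1) (n1 := 15) (n2 := 20) (n3 := 0) (n4 := 0) (n5 := 12) (n6 := 12)
    (by decide +kernel)
  rw [invariants_zero V hV P (hidx P c2)] at e2
  obtain ⟨c3, e3⟩ := sub_char V H (fun c => lstA.contains c) hpr
    (n0 := 1) (n1 := 15) (n2 := 0) (n3 := 20) (n4 := 0) (n5 := 12) (n6 := 12)
    (by decide +kernel)
  rw [invariants_zero V hV H (hidx H hA)] at e3
  obtain ⟨c4, e4⟩ := sub_char V subC3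
    (fun c => lstC3.contains c) (fun _ => Iff.rfl)
    (n0 := 1) (n1 := 0) (n2 := 2) (n3 := 0) (n4 := 0) (n5 := 0) (n6 := 0)
    (by decide +kernel)
  obtain ⟨c5, e5⟩ := sub_char V subC5
    (fun c => lstC5.contains c) (fun _ => Iff.rfl)
    (n0 := 1) (n1 := 0) (n2 := 0) (n3 := 0) (n4 := 0) (n5 := 2) (n6 := 2)
    (by decide +kernel)
  obtain ⟨c6, e6⟩ := sub_char V subS3
    (fun c => lstS3.contains c) (fun _ => Iff.rfl)
    (n0 := 1) (n1 := 3) (n2 := 2) (n3 := 0) (n4 := 0) (n5 := 0) (n6 := 0)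
    (by decide +kernel)
  obtain ⟨c7, e7⟩ := sub_char V subD8
    (fun c => lstD8.contains c) (fun _ => Iff.rfl)
    (n0 := 1) (n1 := 5) (n2 := 0) (n3 := 0) (n4 := 2) (n5 := 0) (n6 := 0)
    (by decide +kernel)
  rw [c4] at e4
  rw [c5] at e5
  rw [c6] at e6
  rw [c7] at e7
  -- the norm
  obtain ⟨d, hd, e8⟩ := char_norm V hV
  have hinv (g : A6) : V.character g⁻¹ = V.character g := by
    have hr (j k : ℕ) (hjk : mulc (mulc (kcode k) (rpc j)) (invc (kcode k)) = invc (rpc j)) :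
        V.character (rep j)⁻¹ = V.character (rep j) := by
      have : (rep j)⁻¹ = kelt k * rep j * (kelt k)⁻¹ := by
        apply Subtype.ext
        apply code_inj
        rw [Subgroup.coe_inv, code_inv]
        simp only [Subgroup.coe_mul, Subgroup.coe_inv, code_mul, code_inv, code_kelt]
        have h0 : code (rep j) = rpc j := code_rp j
        rw [h0, hjk]
      rw [this, FDRep.char_conj]
    have hall (j : ℕ) : V.character (rep j)⁻¹ = V.character (rep j) := by
      match j with
      | 0 => exact hr 0 0 (by decide +kernel)
      | 1 => exact hr 1 0 (by decide +kernel)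
      | 2 => exact hr 2 35 (by decide +kernel)
      | 3 => exact hr 3 35 (by decide +kernel)
      | 4 => exact hr 4 119 (by decide +kernel)
      | 5 => exact hr 5 115 (by decide +kernel)
      | n + 6 => exact hr 6 115 (by decide +kernel)
    obtain ⟨t, rfl⟩ := exists_gelt g
    have : (gelt t)⁻¹ = kelt (t / 8) * (rep (t % 8))⁻¹ * (kelt (t / 8))⁻¹ := by
      rw [gelt]; group
    rw [this, FDRep.char_conj, hall, gelt, FDRep.char_conj]
  simp only [hinv] at e8
  have e9 := sum_pr (fun g => V.character g * V.character g)
    (fun g k => by simp only [FDRep.char_conj]) (fun _ => true)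
    (n0 := 1) (n1 := 45) (n2 := 40) (n3 := 40) (n4 := 90) (n5 := 72) (n6 := 72)
    (by decide +kernel)
  simp only [if_true] at e9
  rw [e8, hG] at e9
  rw [hdim] at hd
  clear e8 hinv hidx
  rw [e0] at e1 e2 e3 e4 e5 e6 e7 e9
  generalize V.character (rep 1) = x1 at *
  generalize V.character (rep 2) = x2 at *
  generalize V.character (rep 3) = x3 at *
  generalize V.character (rep 4) = x4 at *
  generalize V.character (rep 5) = x5 at *
  generalize V.character (rep 6) = x6 at *
  generalize Module.finrank ℚ (Representation.invariants
    (V.ρ.comp subC3.subtype)) = q at *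
  generalize Module.finrank ℚ (Representation.invariants
    (V.ρ.comp subC5.subtype)) = p at *
  generalize Module.finrank ℚ (Representation.invariants
    (V.ρ.comp subS3.subtype)) = s at *
  generalize Module.finrank ℚ (Representation.invariants
    (V.ρ.comp subD8.subtype)) = t at *
  push_cast at e1 e2 e3 e4 e5 e6 e7 e9
  have f1 : (2 * s + q + 2 * p : ℚ) = 9 := by linarith
  have f2 : (6 * t + 8 * q + 9 * p : ℚ) = 45 := by linarith
  have f1' : 2 * s + q + 2 * p = 9 := by exact_mod_cast f1
  have f2' : 6 * t + 8 * q + 9 * p = 45 := by exact_mod_cast f2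
  have hq : q = 3 := by omega
  have hp : p = 1 := by omega
  subst hq hp
  push_cast at e4 e5
  have h2 : x2 = 0 := by linarith
  have h3 : x3 = 0 := by linarith
  have h1 : x1 = 1 := by linarith
  have h4 : x4 = 1 := by linarith
  subst h1 h2 h3 h4
  have h6 : x6 = -2 - x5 := by linarith
  subst h6
  have hsq : ((10 * (d - 1 : ℤ) : ℤ) : ℚ) = (2 * x5 + 2) * (2 * x5 + 2) := by
    push_cast; nlinarith
  have hs : IsSquare (10 * (d - 1 : ℤ)) := by
    rw [← Rat.isSquare_intCast_iff]; exact ⟨_, hsq⟩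
  have hd1 : d = 1 := by
    obtain ⟨k, hk⟩ := hs
    have hd' : (d : ℤ) ≤ 9 := by exact_mod_cast hd
    have hk1 : k < 9 := by nlinarith
    have hk2 : -9 < k := by nlinarith
    interval_cases k <;> omega
  subst hd1
  have h5 : x5 = -1 := by
    norm_num at hsq
    linarith
  subst h5
  norm_num [e0]

theorem indChar_conj [Fintype A6] (H : Subgroup A6) (g k : A6) :
    indChar H (fun _ => (1 : ℚ)) (k * g * k⁻¹) = indChar H (fun _ => (1 : ℚ)) g := by
  unfold indChar
  congr 1
  rw [← Equiv.sum_comp (Equiv.mulLeft k)]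
  apply Finset.sum_congr rfl
  intro x _
  have : (k * x)⁻¹ * (k * g * k⁻¹) * (k * x) = x⁻¹ * g * x := by group
  simp only [Equiv.coe_mulLeft, this]

theorem indChar_rep [Fintype A6] (H : Subgroup A6) (B : List ℕ) (n m : ℕ) (hn : Nat.card H = n)
    (hB : ∀ g : A6, g ∈ H ↔ B.contains (code g) = true) (j : ℕ)
    (hm : tabC.countP (fun u => B.contains (mulc (mulc (invc (u / 8)) (rpc j)) (u / 8))) = m) :
    indChar H (fun _ => (1 : ℚ)) (rep j) = (n : ℚ)⁻¹ * m := by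
  unfold indChar
  rw [← Nat.card_eq_fintype_card, hn]
  congr 1
  rw [← hm, ← count_pr (fun c => B.contains (mulc (mulc (invc c) (rpc j)) c))]
  apply Finset.sum_congr rfl
  intro x _
  have h0 : code (rep j) = rpc j := code_rp j
  simp only [hB, dite_eq_ite, Subgroup.coe_mul, Subgroup.coe_inv, code_mul, code_inv, h0]

end A6char

theorem stmt10
    -- S = ⟨(3,4)(5,6), (1,6,4)(2,3,5)⟩ ≅ S₄
    (x₁ x₂ : A6)
    (hx₁ : (x₁ : Equiv.Perm (Fin 7)) = c[(3 : Fin 7), 4] * c[(5 : Fin 7), 6])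
    (hx₂ : (x₂ : Equiv.Perm (Fin 7)) = c[(1 : Fin 7), 6, 4] * c[(2 : Fin 7), 3, 5])
    (hSiso : Nonempty ((Subgroup.closure {x₁, x₂} : Subgroup A6) ≃* Equiv.Perm (Fin 4)))
    -- A = ⟨(1,5)(4,6), (1,3,2)(4,5,6)⟩ ≅ A₅
    (y₁ y₂ : A6)
    (hy₁ : (y₁ : Equiv.Perm (Fin 7)) = c[(1 : Fin 7), 5] * c[(4 : Fin 7), 6])
    (hy₂ : (y₂ : Equiv.Perm (Fin 7)) = c[(1 : Fin 7), 3, 2] * c[(4 : Fin 7), 5, 6])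
    (hAiso : Nonempty ((Subgroup.closure {y₁, y₂} : Subgroup A6) ≃* alternatingGroup (Fin 5)))
    -- the irreducible character of A₆ of degree 9
    (V : FDRep ℚ A6) (hV : CategoryTheory.Simple V) (hdim : Module.finrank ℚ V = 9) :
    -- Ind_S^{A₆}(ε) − Ind_A^{A₆}(ε′) = χ₆ with ε, ε′ the trivial characters
    ∀ g : A6, indChar (Subgroup.closure {x₁, x₂}) (fun _ => (1 : ℚ)) g -
        indChar (Subgroup.closure {y₁, y₂}) (fun _ => (1 : ℚ)) g = V.character g := by
  have hcS : Nat.card (Subgroup.closure {x₁, x₂} : Subgroup A6) = 24 := by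
    rw [Nat.card_congr hSiso.some.toEquiv, Nat.card_eq_fintype_card, Fintype.card_perm,
      Fintype.card_fin]
    rfl
  have hcA : Nat.card (Subgroup.closure {y₁, y₂} : Subgroup A6) = 60 := by
    rw [Nat.card_congr hAiso.some.toEquiv, nat_card_alternatingGroup]
    simp [Nat.factorial]
  have hS := A6char.closure_mem A6char.lstS x₁ x₂ 1521800 1121008
    (by rw [hx₁]; decide +kernel) (by rw [hx₂]; decide +kernel)
    (by decide +kernel) (by decide +kernel) (by rw [hcS]; decide +kernel)
  have hA := A6char.closure_mem A6char.lstA y₁ y₂ 1107624 1266776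
    (by rw [hy₁]; decide +kernel) (by rw [hy₂]; decide +kernel)
    (by decide +kernel) (by decide +kernel) (by rw [hcA]; decide +kernel)
  obtain ⟨e0, e1, e2, e3, e4, e5, e6⟩ := A6char.all_sum V hV hdim _ hcA hA
  intro g
  obtain ⟨t, rfl⟩ := A6char.exists_gelt g
  rw [A6char.gelt, A6char.indChar_conj, A6char.indChar_conj, FDRep.char_conj]
  have key (j a b : ℕ)
      (ha : A6char.tabC.countP (fun u => A6char.lstS.contains (A6char.mulc (A6char.mulc
        (A6char.invc (u / 8)) (A6char.rpc j)) (u / 8))) = a)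
      (hb : A6char.tabC.countP (fun u => A6char.lstA.contains (A6char.mulc (A6char.mulc
        (A6char.invc (u / 8)) (A6char.rpc j)) (u / 8))) = b)
      (hab : ((24 : ℕ) : ℚ)⁻¹ * a - ((60 : ℕ) : ℚ)⁻¹ * b = V.character (A6char.rep j)) :
      indChar (Subgroup.closure {x₁, x₂}) (fun _ => (1 : ℚ)) (A6char.rep j) -
        indChar (Subgroup.closure {y₁, y₂}) (fun _ => (1 : ℚ)) (A6char.rep j) =
          V.character (A6char.rep j) := by
    rw [A6char.indChar_rep _ _ _ _ hcS hS j ha, A6char.indChar_rep _ _ _ _ hcA hA j hb, hab]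
  match t % 8 with
  | 0 => exact key 0 360 360 (by decide +kernel) (by decide +kernel) (by rw [e0]; norm_num)
  | 1 => exact key 1 72 120 (by decide +kernel) (by decide +kernel) (by rw [e1]; norm_num)
  | 2 => exact key 2 0 0 (by decide +kernel) (by decide +kernel) (by rw [e2]; norm_num)
  | 3 => exact key 3 72 180 (by decide +kernel) (by decide +kernel) (by rw [e3]; norm_num)
  | 4 => exact key 4 24 0 (by decide +kernel) (by decide +kernel) (by rw [e4]; norm_num)
  | 5 => exact key 5 0 60 (by decide +kernel) (by decide +kernel) (by rw [e5]; norm_num)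
  | n + 6 => exact key 6 0 60 (by decide +kernel) (by decide +kernel) (by rw [e6]; norm_num)
end

section
/- Let A₆ be the alternating group of degree 6, H = ⟨(1,2,3), (4,5,6)⟩ ≅ (ℤ/3ℤ)², and C₅ = ⟨(1,2,3,4,5)⟩. Let ψ₂ be the character of H with ψ₂((1,2,3)) = 1 and ψ₂((4,5,6)) = ζ₃, let ψ₅ be the character of H with ψ₅((1,2,3)) = ζ₃ and ψ₅((4,5,6)) = ζ₃, and let σ be the character of C₅ with σ((1,2,3,4,5)) = ζ₅. Then Ind_H^{A₆}(ψ₂) + Ind_H^{A₆}(ψ₅) − Ind_{C₅}^{A₆}(σ) equals the irreducible character χ₄ of A₆ of degree 8 with χ₄((1,2,3,4,5)) = (1−√5)/2 and χ₄((1,3,4,5,2)) = (1+√5)/2. -/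
open scoped Classical

namespace A6Char

open Equiv

/-! ### Encoding permutations of `Fin 7` as natural numbers in base 8 -/

/-- The `i`-th octal digit. -/
def ap (c i : ℕ) : ℕ := Nat.mod (Nat.div c (Nat.pow 8 i)) 8

/-- Composition of encoded permutations. -/
def cmp (a b : ℕ) : ℕ :=
  ap a (ap b 0) + 8 * (ap a (ap b 1) + 8 * (ap a (ap b 2) + 8 * (ap a (ap b 3) +
    8 * (ap a (ap b 4) + 8 * (ap a (ap b 5) + 8 * ap a (ap b 6))))))

/-- Inverse of an encoded permutation. -/
def iv (c : ℕ) : ℕ :=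
  Nat.pow 8 (ap c 1) + 2 * Nat.pow 8 (ap c 2) + 3 * Nat.pow 8 (ap c 3) +
    4 * Nat.pow 8 (ap c 4) + 5 * Nat.pow 8 (ap c 5) + 6 * Nat.pow 8 (ap c 6)

def pcode (g : Perm (Fin 7)) : ℕ :=
  (g 0 : ℕ) + 8 * ((g 1 : ℕ) + 8 * ((g 2 : ℕ) + 8 * ((g 3 : ℕ) +
    8 * ((g 4 : ℕ) + 8 * ((g 5 : ℕ) + 8 * (g 6 : ℕ))))))

/-- The code of an element of `A6`. -/
def code (g : A6) : ℕ := pcode (g : Perm (Fin 7))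

theorem ap_pcode (g : Perm (Fin 7)) (i : Fin 7) : ap (pcode g) i = g i := by
  have h0 := (g 0).2
  have h1 := (g 1).2
  have h2 := (g 2).2
  have h3 := (g 3).2
  have h4 := (g 4).2
  have h5 := (g 5).2
  have h6 := (g 6).2
  have key : ∀ n : ℕ, ap (pcode g) n = pcode g / 8 ^ n % 8 := fun n => rfl
  rw [key]
  unfold pcode
  fin_cases i <;> simp <;> omega

theorem pcode_inj {g h : Perm (Fin 7)} (e : pcode g = pcode h) : g = h := by
  ext i
  rw [← ap_pcode, ← ap_pcode, e]

theorem code_inj : Function.Injective code := fun _ _ e => Subtype.ext (pcode_inj e)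

theorem pcode_mul (g h : Perm (Fin 7)) : pcode (g * h) = cmp (pcode g) (pcode h) := by
  have k0 : ap (pcode h) 0 = h 0 := ap_pcode h 0
  have k1 : ap (pcode h) 1 = h 1 := ap_pcode h 1
  have k2 : ap (pcode h) 2 = h 2 := ap_pcode h 2
  have k3 : ap (pcode h) 3 = h 3 := ap_pcode h 3
  have k4 : ap (pcode h) 4 = h 4 := ap_pcode h 4
  have k5 : ap (pcode h) 5 = h 5 := ap_pcode h 5
  have k6 : ap (pcode h) 6 = h 6 := ap_pcode h 6
  unfold cmp
  rw [k0, k1, k2, k3, k4, k5, k6]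
  simp only [ap_pcode]
  rfl

theorem pcode_inv (g : Perm (Fin 7)) : pcode g⁻¹ = iv (pcode g) := by
  have k1 : ap (pcode g) 1 = g 1 := ap_pcode g 1
  have k2 : ap (pcode g) 2 = g 2 := ap_pcode g 2
  have k3 : ap (pcode g) 3 = g 3 := ap_pcode g 3
  have k4 : ap (pcode g) 4 = g 4 := ap_pcode g 4
  have k5 : ap (pcode g) 5 = g 5 := ap_pcode g 5
  have k6 : ap (pcode g) 6 = g 6 := ap_pcode g 6
  have h : ∀ f : Perm (Fin 7), pcode f = ∑ i : Fin 7, (f i : ℕ) * 8 ^ (i : ℕ) := by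
    intro f
    simp [Fin.sum_univ_succ, pcode]
    ring
  rw [h, ← Equiv.sum_comp g]
  unfold iv
  rw [k1, k2, k3, k4, k5, k6]
  simp [Fin.sum_univ_succ]
  ring

theorem code_mul (g h : A6) : code (g * h) = cmp (code g) (code h) := pcode_mul _ _

theorem code_inv (g : A6) : code g⁻¹ = iv (code g) := pcode_inv _

theorem code_one : code 1 = 1754760 := rfl

/-! ### Listing the group -/

def Llit : List ℕ := [
  1754760, 1753808, 1754200, 1745688, 1746528, 1747144, 1751120, 1750280, 1749664, 1742048, 1743000,
  1742608, 1628368, 1627416, 1627808, 1619296, 1620136, 1620752, 1624728, 1623888, 1623272, 1615656,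
  1616608, 1616216, 1645336, 1644384, 1644776, 1656424, 1657544, 1655640, 1659616, 1661016, 1660680,
  1653064, 1651496, 1653344, 1680224, 1681512, 1682184, 1693832, 1692432, 1692768, 1676584, 1677984,
  1677648, 1690192, 1688904, 1688232, 1717352, 1718920, 1717072, 1710800, 1709400, 1709736, 1713992,
  1712872, 1714776, 1725080, 1726032, 1725640, 345968, 347368, 347032, 351512, 350112, 350448,
  342440, 342832, 343392, 355040, 354648, 354088, 469224, 469784, 468832, 473760, 473424,
  472360, 476504, 476840, 477904, 481040, 480480, 481432, 451864, 452256, 452816, 444304,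
  443632, 445592, 437472, 436632, 436016, 440496, 441616, 439712, 384160, 383376, 382256,
  371056, 372008, 371616, 387856, 386400, 387240, 378280, 379568, 380240, 408464, 406896,
  408744, 419048, 420504, 419664, 415408, 416976, 415128, 404824, 403368, 404208, 1266384,
  1266776, 1267336, 1258824, 1258152, 1260112, 1251992, 1251152, 1250536, 1255016, 1256136, 1254232,
  1141336, 1140552, 1139432, 1120168, 1121008, 1121624, 1137864, 1135512, 1136240, 1127280, 1129576,
  1129352, 1158472, 1156008, 1157744, 1168048, 1170512, 1168776, 1172584, 1174152, 1172304, 1153936,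
  1152368, 1154216, 1095080, 1096368, 1097040, 1108688, 1107288, 1107624, 1091440, 1092840, 1092504,
  1105048, 1103760, 1103088, 1218224, 1219792, 1217944, 1223768, 1222536, 1221360, 1225616, 1225840,
  1227912, 1238216, 1237656, 1238608, 644000, 645232, 646408, 649544, 647976, 649824, 629552,
  630112, 629160, 642152, 641928, 639856, 670320, 671048, 668584, 662760, 662424, 661360,
  677768, 676592, 679000, 680792, 681576, 682696, 739144, 738024, 739928, 742168, 743008,
  743624, 735336, 736008, 734048, 727776, 727384, 726824, 583912, 584472, 583520, 572320,
  571760, 572712, 576856, 575400, 576240, 579376, 580832, 579992, 695576, 694176, 694512,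
  706160, 707784, 705432, 713440, 714840, 714504, 702856, 701232, 703584, 1467480, 1468040,
  1467088, 1447824, 1447152, 1449112, 1453256, 1450904, 1451632, 1454768, 1457232, 1455496, 1428616,
  1426320, 1426544, 1418032, 1420384, 1419656, 1435728, 1434888, 1434272, 1414560, 1415344, 1416464,
  1358224, 1357104, 1359008, 1369312, 1370264, 1369872, 1361584, 1363152, 1361304, 1355032, 1353632,
  1353968, 1382192, 1383648, 1382808, 1395800, 1394568, 1393392, 1389472, 1390704, 1391880, 1403080,
  1401624, 1402464, 1516256, 1517656, 1517320, 1521800, 1520400, 1520736, 1512728, 1513120, 1513680,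
  1525328, 1524936, 1524376, 845096, 846496, 846160, 838544, 836976, 838824, 830816, 829864,
  830256, 841904, 843024, 841120, 957600, 956816, 955696, 960624, 961800, 959392, 975632,
  975968, 977032, 968072, 967344, 969808, 938896, 939120, 941192, 943432, 942760, 944720,
  924336, 925008, 923048, 928872, 928648, 926576, 871024, 871752, 869288, 859432, 859040,
  858480, 874888, 873264, 875616, 877408, 878696, 879368, 993608, 992040, 993888, 1004192,
  1005648, 1004808, 1000552, 1002120, 1000272, 989968, 988512, 989352]

def HL : List ℕ := [
  1754760, 1267336, 1468040, 1753808, 1266384, 1467088, 1754200, 1266776, 1467480]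

def CL : List ℕ := [
  1754760, 1628368, 1645336, 1680224, 1717352]

def SC2 : List ℕ := [
  1754760, 1751120]

def SC2neg : List ℕ := [
  1751120]

def SC3a : List ℕ := [
  1754760, 1753808, 1754200]

def SC3b : List ℕ := [
  1754760, 1266384, 1467480]

def SC4 : List ℕ := [
  1754760, 1513680, 1745688, 1520736]

def SS3 : List ℕ := [
  1754760, 1693832, 1718920, 1726032, 1751120, 1690192]

def SS3neg : List ℕ := [
  1726032, 1751120, 1690192]

def SA4 : List ℕ := [
  1754760, 1747144, 1750280, 1751120, 1753808, 1742608, 1754200, 1743000, 1745688, 1746528, 1749664,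
  1742048]

def SA4b : List ℕ := [
  1754760, 1521800, 1525328, 1751120, 584472, 351512, 355040, 580832, 1156008, 923048, 926576,
  1152368]

def SB : List ℕ := [
  1754760, 977032, 1227912, 1140552, 1653064, 871752, 1238608, 1751120, 969808, 1623888, 846160,
  1097040, 742168, 1512728, 469784, 1450904, 415128, 662424, 1516256, 480480, 727776, 644000,
  1414560, 371616, 1656424, 878696, 1129576, 1107624, 1620136, 838824, 676592, 1447152, 404208,
  1418032, 382256, 629552]

/-- Boolean membership. -/
def mem (c : ℕ) (l : List ℕ) : Bool := l.any (Nat.beq c)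

theorem mem_iff {c : ℕ} {l : List ℕ} : mem c l = true ↔ c ∈ l := by
  simp [mem, List.any_eq_true, Nat.beq_eq]

def prodL (a b : List ℕ) : List ℕ := a.flatMap fun x => b.map fun y => cmp x y

def IsC (c : ℕ) : Prop := ∃ g : A6, code g = c

theorem IsC.cmp {a b : ℕ} : IsC a → IsC b → IsC (cmp a b) := by
  rintro ⟨g, rfl⟩ ⟨h, rfl⟩
  exact ⟨g * h, code_mul g h⟩

theorem prodL_isC {a b : List ℕ} (ha : ∀ c ∈ a, IsC c) (hb : ∀ c ∈ b, IsC c) :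
    ∀ c ∈ prodL a b, IsC c := by
  intro c hc
  simp only [prodL, List.mem_flatMap, List.mem_map] at hc
  obtain ⟨x, hx, y, hy, rfl⟩ := hc
  exact (ha x hx).cmp (hb y hy)

def pows (c : ℕ) : ℕ → List ℕ
  | 0 => []
  | n + 1 => 1754760 :: (pows c n).map (fun x => cmp x c)

theorem pows_isC {c : ℕ} (hc : IsC c) : ∀ n, ∀ d ∈ pows c n, IsC d
  | 0 => by simp [pows]
  | n + 1 => by
    intro d hd
    simp only [pows, List.mem_cons, List.mem_map] at hd
    rcases hd with rfl | ⟨x, hx, rfl⟩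
    · exact ⟨1, code_one⟩
    · exact (pows_isC hc n x hx).cmp hc

theorem isC_of (g : Perm (Fin 7)) (h : Perm.sign g = 1) (h0 : g 0 = 0) {c : ℕ} (hc : pcode g = c) :
    IsC c :=
  ⟨⟨g, Subgroup.mem_inf.2 ⟨Perm.mem_alternatingGroup.2 h, h0⟩⟩, hc⟩

theorem Llit_eq : Llit = prodL (pows 1266384 3) (prodL (pows 345968 2) (prodL (pows 1628368 5)
    (prodL (pows 1751120 2) (prodL (pows 1745688 2) (pows 1753808 3))))) := by
  decide +kernel

theorem Llit_isC : ∀ c ∈ Llit, IsC c := by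
  rw [Llit_eq]
  have hx : IsC 1266384 := isC_of (c[(1 : Fin 7), 2, 3] * c[(4 : Fin 7), 5, 6])
    (by decide +kernel) (by decide +kernel) (by decide +kernel)
  have hy : IsC 345968 := isC_of (c[(1 : Fin 7), 6] * c[(2 : Fin 7), 5])
    (by decide +kernel) (by decide +kernel) (by decide +kernel)
  have hw : IsC 1628368 := isC_of (c[(1 : Fin 7), 2, 3, 4, 5])
    (by decide +kernel) (by decide +kernel) (by decide +kernel)
  have ha : IsC 1751120 := isC_of (c[(1 : Fin 7), 2] * c[(3 : Fin 7), 4])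
    (by decide +kernel) (by decide +kernel) (by decide +kernel)
  have hb : IsC 1745688 := isC_of (c[(1 : Fin 7), 3] * c[(2 : Fin 7), 4])
    (by decide +kernel) (by decide +kernel) (by decide +kernel)
  have hz : IsC 1753808 := isC_of (c[(1 : Fin 7), 2, 3])
    (by decide +kernel) (by decide +kernel) (by decide +kernel)
  exact prodL_isC (pows_isC hx _) (prodL_isC (pows_isC hy _) (prodL_isC (pows_isC hw _)
    (prodL_isC (pows_isC ha _) (prodL_isC (pows_isC hb _) (pows_isC hz _)))))

theorem Llit_nodup : Llit.Nodup := by decide +kernel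

theorem Llit_length : Llit.length = 360 := by decide +kernel

theorem card_A6_le : Nat.card A6 ≤ 360 := by
  have hc : Nat.card (alternatingGroup (Fin 6)) = 360 := by
    rw [nat_card_alternatingGroup]; simp; decide
  rw [← hc]
  have key : ∀ g : A6, Perm.decomposeFin.symm (0, (Perm.decomposeFin (g : Perm (Fin 7))).2) = g := by
    intro g
    have h0 : (g : Perm (Fin 7)) 0 = 0 := (Subgroup.mem_inf.1 g.2).2
    have h1 : Perm.decomposeFin.symm (Perm.decomposeFin (g : Perm (Fin 7))) = g :=
      Equiv.symm_apply_apply _ _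
    have h2 : (Perm.decomposeFin (g : Perm (Fin 7))).1 = 0 := by
      have := Perm.decomposeFin_symm_apply_zero (Perm.decomposeFin (g : Perm (Fin 7))).1
        (Perm.decomposeFin (g : Perm (Fin 7))).2
      rw [← this]
      exact (congrArg (fun f : Perm (Fin 7) => f 0) h1).trans h0
    rw [← h2]
    exact h1
  refine Nat.card_le_card_of_injective (fun g : A6 =>
    (⟨(Perm.decomposeFin (g : Perm (Fin 7))).2, ?_⟩ : alternatingGroup (Fin 6))) ?_
  · rw [Perm.mem_alternatingGroup]
    have h3 : Perm.sign (g : Perm (Fin 7)) = 1 :=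
      Perm.mem_alternatingGroup.1 (Subgroup.mem_inf.1 g.2).1
    rw [← key g, Perm.decomposeFin.symm_sign] at h3
    simpa using h3
  · intro g h e
    have e' := congrArg Subtype.val e
    simp only at e'
    exact Subtype.ext (by rw [← key g, ← key h, e'])

theorem image_code : (Finset.univ : Finset A6).image code = Llit.toFinset := by
  symm
  apply Finset.eq_of_subset_of_card_le
  · intro c hc
    obtain ⟨g, hg⟩ := Llit_isC c (List.mem_toFinset.1 hc)
    exact Finset.mem_image.2 ⟨g, Finset.mem_univ _, hg⟩
  · rw [List.toFinset_card_of_nodup Llit_nodup, Llit_length]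
    refine Finset.card_image_le.trans ?_
    rw [Finset.card_univ, ← Nat.card_eq_fintype_card]
    exact card_A6_le

theorem code_mem (g : A6) : code g ∈ Llit := by
  rw [← List.mem_toFinset, ← image_code]
  exact Finset.mem_image_of_mem _ (Finset.mem_univ _)

/-- Sums over a subset of `A6` given by a list of codes. -/
theorem sum_code {M : Type*} [AddCommMonoid M] (S : List ℕ) (hn : S.Nodup) (hS : ∀ c ∈ S, c ∈ Llit)
    (f : ℕ → M) :
    ∑ g ∈ (Finset.univ : Finset A6).filter (fun g => code g ∈ S), f (code g) = (S.map f).sum := by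
  rw [← List.sum_toFinset f hn, ← Finset.sum_image (f := f) (g := code)
    (fun _ _ _ _ e => code_inj e)]
  congr 1
  ext c
  simp only [Finset.mem_image, Finset.mem_filter, Finset.mem_univ, true_and, List.mem_toFinset]
  constructor
  · rintro ⟨g, hg, rfl⟩; exact hg
  · intro hc
    obtain ⟨g, rfl⟩ := Llit_isC c (hS c hc)
    exact ⟨g, hc, rfl⟩

theorem sum_univ_code {M : Type*} [AddCommMonoid M] (f : ℕ → M) :
    ∑ g : A6, f (code g) = (Llit.map f).sum := by
  rw [← sum_code Llit Llit_nodup (fun _ h => h) f]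
  congr 1
  ext g
  simp [code_mem]

/-- Tag counting. -/
def cnts (m : ℕ) (l : List ℕ) : List ℕ := (List.range m).map fun k => l.countP (Nat.beq k)

theorem sum_tags {M : Type*} [Semiring M] (m : ℕ) (l : List ℕ) (hl : ∀ c ∈ l, c < m) (f : ℕ → M) :
    (l.map f).sum = ∑ k ∈ Finset.range m, (l.countP (Nat.beq k) : M) * f k := by
  induction l with
  | nil => simp
  | cons a t ih =>
    rw [List.map_cons, List.sum_cons, ih (fun c hc => hl c (List.mem_cons_of_mem _ hc))]
    have ha : a ∈ Finset.range m := Finset.mem_range.2 (hl a (List.mem_cons_self ..))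
    have hfa : f a = ∑ k ∈ Finset.range m, (if k = a then 1 else 0) * f k := by
      simp [Finset.mem_range.1 ha]
    rw [hfa, ← Finset.sum_add_distrib]
    refine Finset.sum_congr rfl fun k _ => ?_
    rw [List.countP_cons]
    by_cases h : k = a
    · subst h; simp [add_mul, add_comm]
    · have h' : Nat.beq k a = false := by
        rw [Bool.eq_false_iff]; intro h2; exact h (Nat.eq_of_beq_eq_true h2)
      simp [h, h']

/-! ### Conjugacy classes -/

/-- Codes of class representatives. -/
def crep : ℕ → ℕ
  | 0 => 1754760
  | 1 => 1751120
  | 2 => 1753808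
  | 3 => 1266384
  | 4 => 1513680
  | 5 => 1628368
  | _ => 1661016

def conjTest (c x r : ℕ) : Bool :=
  Nat.beq (ap c (ap x 1)) (ap x (ap r 1)) && Nat.beq (ap c (ap x 2)) (ap x (ap r 2)) &&
    Nat.beq (cmp c x) (cmp x r)

/-- Number of fixed points among `0,…,6`. -/
def nfix (c : ℕ) : ℕ := (List.range 7).countP fun i => Nat.beq (ap c i) i

/-- Class index of a code. -/
def cls (c : ℕ) : ℕ :=
  match nfix c with
  | 7 => 0
  | 3 => 1
  | 4 => 2
  | 1 => if Nat.beq (nfix (cmp c c)) 1 then 3 else 4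
  | _ => if Llit.any (fun x => conjTest c x 1628368) then 5 else 6

theorem cls_check : (Llit.all fun c => Llit.any fun x => conjTest c x (crep (cls c))) = true := by
  decide +kernel

theorem cls_lt (c : ℕ) : cls c < 7 := by
  unfold cls
  split <;> try split
  all_goals omega

theorem crep_mem (k : ℕ) : crep k ∈ Llit := by
  rw [← mem_iff]
  unfold crep
  split <;> decide +kernel

noncomputable def rep (k : ℕ) : A6 := (Llit_isC _ (crep_mem k)).choose

theorem code_rep (k : ℕ) : code (rep k) = crep k := (Llit_isC _ (crep_mem k)).choose_spec

theorem exists_conj (g : A6) : ∃ x : A6, g = x * rep (cls (code g)) * x⁻¹ := by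
  have h := List.all_eq_true.1 cls_check _ (code_mem g)
  obtain ⟨c, hc, h2⟩ := List.any_eq_true.1 h
  obtain ⟨x, rfl⟩ := Llit_isC c hc
  simp only [conjTest, Bool.and_eq_true] at h2
  have h3 := Nat.eq_of_beq_eq_true h2.2
  rw [← code_rep, ← code_mul, ← code_mul] at h3
  exact ⟨x, by rw [← code_inj h3]; group⟩

/-- A class function is determined by its values on representatives. -/
theorem classFun_eq {K : Type*} (f : A6 → K) (hf : ∀ x g, f (x * g * x⁻¹) = f g) (g : A6) :
    f g = f (rep (cls (code g))) := by
  obtain ⟨x, hx⟩ := exists_conj g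
  conv_lhs => rw [hx]
  exact hf _ _

/-! ### Idempotents attached to sign characters of subgroups -/

theorem sum_sign_char {K : Type} [Field K] [CharZero K] (V : FDRep K A6) (S : Finset A6)
    (hS : S.Nonempty) (s : A6 → K)
    (hmul : ∀ a ∈ S, ∀ b ∈ S, a * b ∈ S ∧ s (a * b) = s a * s b) :
    ∃ n : ℕ, ∑ a ∈ S, s a * V.character a = (S.card : K) * n := by
  set E : V →ₗ[K] V := ∑ a ∈ S, s a • V.ρ a with hE
  have hcard : (S.card : K) ≠ 0 := by
    exact_mod_cast hS.card_pos.ne'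
  have h1 : ∀ a ∈ S, (s a • V.ρ a) * E = E := by
    intro a ha
    have himg : S.image (fun b => a * b) = S := by
      apply Finset.eq_of_subset_of_card_le
      · intro c hc
        obtain ⟨b, hb, rfl⟩ := Finset.mem_image.1 hc
        exact (hmul a ha b hb).1
      · rw [Finset.card_image_of_injective _ (mul_right_injective a)]
    conv_rhs => rw [hE, ← himg, Finset.sum_image (fun _ _ _ _ e => mul_right_injective a e)]
    rw [hE, Finset.mul_sum]
    refine Finset.sum_congr rfl fun b hb => ?_
    rw [(hmul a ha b hb).2, map_mul, smul_mul_smul_comm]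
  have h2 : E * E = (S.card : K) • E := by
    conv_lhs => rw [hE, Finset.sum_mul, ← hE]
    rw [Finset.sum_congr rfl h1, Finset.sum_const, Nat.cast_smul_eq_nsmul]
  have h3 : IsIdempotentElem ((S.card : K)⁻¹ • E) := by
    unfold IsIdempotentElem
    rw [smul_mul_smul_comm, h2, smul_smul]
    congr 1
    field_simp
  have h4 := (LinearMap.IsIdempotentElem.isProj_range _ h3).trace
  refine ⟨Module.finrank K (LinearMap.range ((S.card : K)⁻¹ • E)), ?_⟩
  · rw [← h4, map_smul, smul_eq_mul, ← mul_assoc, mul_inv_cancel₀ hcard, one_mul, hE, map_sum]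
    refine Finset.sum_congr rfl fun a _ => ?_
    rw [map_smul, smul_eq_mul]
    rfl

/-- For a simple nontrivial representation the character sums to zero. -/
theorem sum_char_eq_zero {K : Type} [Field K] [CharZero K] (V : FDRep K A6)
    (hV : CategoryTheory.Simple V) (g₀ : A6) (hg₀ : V.ρ g₀ ≠ 1) :
    ∑ g : A6, V.character g = 0 := by
  set E : V →ₗ[K] V := ∑ a : A6, V.ρ a with hE
  have h1 : ∀ a, V.ρ a * E = E := by
    intro a
    rw [hE, Finset.mul_sum]
    simp_rw [← map_mul]
    exact Fintype.sum_equiv (Equiv.mulLeft a) _ _ (fun _ => rfl)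
  have h2 : ∀ a, E * V.ρ a = E := by
    intro a
    rw [hE, Finset.sum_mul]
    simp_rw [← map_mul]
    exact Fintype.sum_equiv (Equiv.mulRight a) _ _ (fun _ => rfl)
  let f : V ⟶ V := ⟨CategoryTheory.InducedCategory.homMk (ModuleCat.ofHom E), fun g => by
    ext1
    exact (h2 g).trans (h1 g).symm⟩
  have htr : ∑ g : A6, V.character g = LinearMap.trace K V E := by
    rw [hE, map_sum]; rfl
  rw [htr]
  by_cases hf : f = 0
  · have : E = 0 := by
      have := congrArg (fun q : V ⟶ V => q.hom.hom.hom) hf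
      exact this
    rw [this, map_zero]
  · exfalso
    have hiso := CategoryTheory.isIso_of_hom_simple hf
    apply hg₀
    have h3 : CategoryTheory.CategoryStruct.comp (CategoryTheory.inv f) f =
        CategoryTheory.CategoryStruct.id V := CategoryTheory.IsIso.inv_hom_id f
    have h4 : E * (CategoryTheory.inv f).hom.hom.hom = 1 :=
      congrArg (fun q : V ⟶ V => q.hom.hom.hom) h3
    calc V.ρ g₀ = V.ρ g₀ * (E * (CategoryTheory.inv f).hom.hom.hom) := by rw [h4, mul_one]
      _ = 1 := by rw [← mul_assoc, h1, h4]

theorem sum_tags' {M : Type*} [Semiring M] (m : ℕ) (l v : List ℕ) (hl : ∀ c ∈ l, c < m)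
    (hv : cnts m l = v) (f : ℕ → M) :
    (l.map f).sum = ∑ k ∈ Finset.range m, ((v.getD k 0 : ℕ) : M) * f k := by
  rw [sum_tags m l hl, ← hv]
  refine Finset.sum_congr rfl fun k hk => ?_
  have hk' := Finset.mem_range.1 hk
  simp [cnts, List.getD, hk']

/-! ### Multiplicities in restrictions to subgroups -/

/-- Class index shifted by 7 for elements on which the sign is `-1`. -/
def stag (N : List ℕ) (c : ℕ) : ℕ := cond (mem c N) (cls c + 7) (cls c)

def subCheck (S N : List ℕ) : Bool :=
  S.all fun a => mem a Llit && S.all fun b =>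
    mem (cmp a b) S && ((mem (cmp a b) N) == (xor (mem a N) (mem b N)))

theorem sub_sum {K : Type} [Field K] [CharZero K] (V : FDRep K A6) (S N v : List ℕ)
    (hn : S.Nodup) (hc : 1754760 ∈ S) (hS : subCheck S N = true)
    (hv : cnts 14 (S.map (stag N)) = v) :
    ∃ n : ℕ, ∑ k ∈ Finset.range 14, ((v.getD k 0 : ℕ) : K) *
      (if k < 7 then V.character (rep k) else - V.character (rep (k - 7))) = (S.length : K) * n := by
  have hS1 : ∀ a ∈ S, a ∈ Llit ∧ ∀ b ∈ S, cmp a b ∈ S ∧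
      mem (cmp a b) N = (xor (mem a N) (mem b N)) := by
    intro a ha
    have h := List.all_eq_true.1 hS a ha
    rw [Bool.and_eq_true, mem_iff, List.all_eq_true] at h
    refine ⟨h.1, fun b hb => ?_⟩
    have h' := h.2 b hb
    rw [Bool.and_eq_true, mem_iff, beq_iff_eq] at h'
    exact h'
  have hsub : ∀ c ∈ S, c ∈ Llit := fun c h => (hS1 c h).1
  let T : Finset A6 := (Finset.univ : Finset A6).filter (fun g => code g ∈ S)
  have hT : ∀ g, g ∈ T ↔ code g ∈ S := fun g => by simp [T]
  let s : ℕ → K := fun c => cond (mem c N) (-1) 1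
  obtain ⟨n, hn'⟩ := sum_sign_char V T ⟨1, (hT 1).2 (by rw [code_one]; exact hc)⟩
    (fun g => s (code g)) (by
      intro a ha b hb
      rw [hT] at ha hb
      have h := (hS1 _ ha).2 _ hb
      refine ⟨(hT _).2 (by rw [code_mul]; exact h.1), ?_⟩
      simp only [s, code_mul, h.2]
      cases mem (code a) N <;> cases mem (code b) N <;> simp)
  refine ⟨n, ?_⟩
  have hcard : T.card = S.length := by
    have := sum_code S hn hsub (fun _ => (1 : ℕ))
    simpa using this
  rw [← hcard, ← hn']
  have hclass : ∀ g : A6, V.character g = V.character (rep (cls (code g))) :=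
    classFun_eq V.character (fun x g => FDRep.char_conj V g x)
  have h1 : ∑ g ∈ T, s (code g) * V.character g =
      ∑ g ∈ T, (fun c => s c * V.character (rep (cls c))) (code g) :=
    Finset.sum_congr rfl fun g _ => by rw [hclass g]
  rw [h1.trans (sum_code S hn hsub (fun c => s c * V.character (rep (cls c)))), ← sum_tags' 14 (S.map (stag N)) v ?_ hv
    (fun k => if k < 7 then V.character (rep k) else - V.character (rep (k - 7)))]
  · rw [List.map_map]
    congr 1
    refine List.map_congr_left fun c _ => ?_
    have := cls_lt c
    by_cases hb : mem c N = true
    · simp [Function.comp, stag, s, hb]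
    · rw [Bool.not_eq_true] at hb
      simp [Function.comp, stag, s, hb, this]
  · intro c hc
    obtain ⟨d, _, rfl⟩ := List.mem_map.1 hc
    have := cls_lt d
    unfold stag
    cases mem d N <;> simp <;> omega

/-! ### Induced characters -/

theorem indChar_conj {K : Type} [Field K] (H : Subgroup A6) (ψ : H → K) (y g : A6) :
    indChar H ψ (y * g * y⁻¹) = indChar H ψ g := by
  have key : ∀ g, indChar H ψ g = (Fintype.card H : K)⁻¹ *
      ∑ x : A6, (fun z : A6 => if h : z ∈ H then ψ ⟨z, h⟩ else 0) (x⁻¹ * g * x) := fun _ => rfl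
  rw [key, key]
  congr 1
  refine Fintype.sum_equiv (Equiv.mulLeft y⁻¹) _ _ fun x => ?_
  have hx : x⁻¹ * (y * g * y⁻¹) * x = (y⁻¹ * x)⁻¹ * g * (y⁻¹ * x) := by group
  rw [hx]
  rfl

/-- Exponent tag of a code with respect to a list of codes. -/
def etag (hl : List ℕ) (m : ℕ) (e : ℕ → ℕ) (c : ℕ) : ℕ := cond (mem c hl) (e c % m) m

theorem indChar_rep {K : Type} [Field K] (H : Subgroup A6) (ψ : H → K) (hl : List ℕ) (m : ℕ)
    (hm : 0 < m) (e : ℕ → ℕ) (ζ : K) (hζ : ζ ^ m = 1)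
    (hmem : ∀ h, h ∈ H ↔ code h ∈ hl) (hψ : ∀ h (hh : h ∈ H), ψ ⟨h, hh⟩ = ζ ^ e (code h))
    (j : ℕ) (v : List ℕ)
    (hv : cnts (m + 1) (Llit.map fun x => etag hl m e (cmp (cmp (iv x) (crep j)) x)) = v) :
    indChar H ψ (rep j) = (Nat.card H : K)⁻¹ *
      ∑ k ∈ Finset.range m, ((v.getD k 0 : ℕ) : K) * ζ ^ k := by
  unfold indChar
  rw [Fintype.card_eq_nat_card]
  congr 1
  have h1 : ∀ z : A6, (if h : z ∈ H then ψ ⟨z, h⟩ else 0) =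
      (fun k => if k < m then ζ ^ k else 0) (etag hl m e (code z)) := by
    intro z
    by_cases hz : z ∈ H
    · rw [dif_pos hz, hψ]
      have : mem (code z) hl = true := mem_iff.2 ((hmem z).1 hz)
      simp only [etag, this, cond_true, Nat.mod_lt _ hm, if_true]
      exact pow_eq_pow_mod _ hζ
    · rw [dif_neg hz]
      have : mem (code z) hl = false := by
        rw [Bool.eq_false_iff]
        intro h
        exact hz ((hmem z).2 (mem_iff.1 h))
      simp [etag, this]
  simp_rw [h1, code_mul, code_inv, code_rep]
  rw [sum_univ_code (fun c => (fun k => if k < m then ζ ^ k else 0)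
    (etag hl m e (cmp (cmp (iv c) (crep j)) c)))]
  have h2 := sum_tags' (m + 1) (Llit.map fun x => etag hl m e (cmp (cmp (iv x) (crep j)) x)) v
    (by
      intro c hc
      obtain ⟨d, _, rfl⟩ := List.mem_map.1 hc
      unfold etag
      cases mem (cmp (cmp (iv d) (crep j)) d) hl
      · simp
      · have := Nat.mod_lt (e (cmp (cmp (iv d) (crep j)) d)) hm
        simp only [cond_true]; omega) hv (fun k => if k < m then ζ ^ k else 0)
  rw [List.map_map] at h2
  refine h2.trans ?_
  rw [Finset.sum_range_succ]
  simp only [lt_irrefl, if_false, mul_zero, add_zero]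
  exact Finset.sum_congr rfl fun k hk => by rw [if_pos (Finset.mem_range.1 hk)]

def homCheck (hl : List ℕ) (e : ℕ → ℕ) (n : ℕ) : Bool :=
  mem 1754760 hl && Nat.beq (e 1754760) 0 && hl.all fun a =>
    (mem (iv a) hl && Nat.beq ((e a + e (iv a)) % n) 0) &&
    hl.all fun b => mem (cmp a b) hl && Nat.beq ((e a + e b) % n) (e (cmp a b) % n)

theorem hom_val {K : Type} [Field K] (H : Subgroup A6) (T : Set A6) (hH : H = Subgroup.closure T)
    (hl : List ℕ) (e : ℕ → ℕ) (n : ℕ) (ζ : K) (hζ : ζ ^ n = 1) (ψ : H →* K)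
    (hT : ∀ t (ht : t ∈ H), t ∈ T → code t ∈ hl ∧ ψ ⟨t, ht⟩ = ζ ^ e (code t))
    (hch : homCheck hl e n = true) :
    ∀ h (hh : h ∈ H), code h ∈ hl ∧ ψ ⟨h, hh⟩ = ζ ^ e (code h) := by
  subst hH
  simp only [homCheck, Bool.and_eq_true, mem_iff, List.all_eq_true, Nat.beq_eq] at hch
  obtain ⟨⟨hc1, hc2⟩, hc3⟩ := hch
  intro h hh
  induction hh using Subgroup.closure_induction with
  | mem x hx => exact hT x _ hx
  | one =>
    rw [code_one, hc2, pow_zero]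
    exact ⟨hc1, map_one ψ⟩
  | mul x y hx hy ihx ihy =>
    obtain ⟨h1, h2⟩ := (hc3 _ ihx.1).2 _ ihy.1
    rw [code_mul]
    refine ⟨h1, ?_⟩
    have : ψ ⟨x * y, mul_mem hx hy⟩ = ψ ⟨x, hx⟩ * ψ ⟨y, hy⟩ := map_mul ψ ⟨x, hx⟩ ⟨y, hy⟩
    rw [this, ihx.2, ihy.2, ← pow_add, pow_eq_pow_mod _ hζ, h2, ← pow_eq_pow_mod _ hζ]
  | inv x hx ihx =>
    obtain ⟨h1, h2⟩ := (hc3 _ ihx.1).1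
    rw [code_inv]
    refine ⟨h1, ?_⟩
    have h3 : ψ ⟨x, hx⟩ * ψ ⟨x⁻¹, inv_mem hx⟩ = 1 := by
      rw [← map_mul]
      convert map_one ψ
      simp
    have h4 : ψ ⟨x, hx⟩ * ζ ^ e (iv (code x)) = 1 := by
      rw [ihx.2, ← pow_add, pow_eq_pow_mod _ hζ, h2, pow_zero]
    exact mul_left_cancel₀ (left_ne_zero_of_mul_eq_one h3) (h3.trans h4.symm)

def pw (c : ℕ) : ℕ → ℕ
  | 0 => 1754760
  | n + 1 => cmp (pw c n) c

theorem code_pow (g : A6) (n : ℕ) : code (g ^ n) = pw (code g) n := by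
  induction n with
  | zero => rw [pow_zero]; exact code_one
  | succ n ih => rw [pow_succ, code_mul, ih]; rfl

theorem HL_words : (HL.all fun c => (List.range 3).any fun i => (List.range 3).any fun j =>
    Nat.beq c (cmp (pw 1753808 i) (pw 1267336 j))) = true := by decide +kernel

theorem CL_words : (CL.all fun c => (List.range 5).any fun i => Nat.beq c (pw 1628368 i)) = true := by
  decide +kernel

def e2 (c : ℕ) : ℕ := ap c 4 - 4
def e5 (c : ℕ) : ℕ := (ap c 1 - 1) + (ap c 4 - 4)
def es (c : ℕ) : ℕ := ap c 1 - 1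

/-! ### The character values -/

theorem char_values {K : Type} [Field K] [CharZero K] (V : FDRep K A6)
    (hV : CategoryTheory.Simple V) (h0 : V.character (rep 0) = 8)
    (h56 : V.character (rep 5) + V.character (rep 6) = 1) :
    V.character (rep 1) = 0 ∧ V.character (rep 2) = -1 ∧ V.character (rep 3) = -1 ∧
      V.character (rep 4) = 0 := by
  have hone : V.character 1 = 8 := by
    rw [← h0]; congr 1; exact code_inj (by rw [code_rep]; rfl)
  have hg : ∃ g, V.ρ g ≠ 1 := by
    by_contra! hg
    have h8 : ∀ g, V.character g = 8 := by
      intro g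
      rw [← hone]
      change LinearMap.trace K V (V.ρ g) = LinearMap.trace K V (V.ρ 1)
      rw [hg g, hg 1]
    rw [h8, h8] at h56
    norm_num at h56
  obtain ⟨g₀, hg₀⟩ := hg
  have hG := sum_char_eq_zero V hV g₀ hg₀
  have hclass : ∀ g : A6, V.character g = V.character (rep (cls (code g))) :=
    classFun_eq V.character (fun x g => FDRep.char_conj V g x)
  rw [Finset.sum_congr rfl (fun g _ => hclass g),
    sum_univ_code (fun c => V.character (rep (cls c)))] at hG
  have hG2 := sum_tags' 7 (Llit.map cls) [1, 45, 40, 40, 90, 72, 72]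
    (by intro c hc; obtain ⟨d, _, rfl⟩ := List.mem_map.1 hc; exact cls_lt d)
    (by decide +kernel) (fun k => V.character (rep k))
  rw [List.map_map] at hG2
  have hG3 := hG2.symm.trans hG
  obtain ⟨n1, e1⟩ := sub_sum V SC2 [] [1, 1, 0, 0, 0, 0, 0, 0, 0, 0, 0, 0, 0, 0]
    (by decide +kernel) (by decide +kernel) (by decide +kernel) (by decide +kernel)
  obtain ⟨n2, e2⟩ := sub_sum V SC2 SC2neg [1, 0, 0, 0, 0, 0, 0, 0, 1, 0, 0, 0, 0, 0]
    (by decide +kernel) (by decide +kernel) (by decide +kernel) (by decide +kernel)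
  obtain ⟨n3, e3⟩ := sub_sum V SC3a [] [1, 0, 2, 0, 0, 0, 0, 0, 0, 0, 0, 0, 0, 0]
    (by decide +kernel) (by decide +kernel) (by decide +kernel) (by decide +kernel)
  obtain ⟨n4, e4⟩ := sub_sum V SC3b [] [1, 0, 0, 2, 0, 0, 0, 0, 0, 0, 0, 0, 0, 0]
    (by decide +kernel) (by decide +kernel) (by decide +kernel) (by decide +kernel)
  obtain ⟨n5, e5⟩ := sub_sum V SC4 [] [1, 1, 0, 0, 2, 0, 0, 0, 0, 0, 0, 0, 0, 0]
    (by decide +kernel) (by decide +kernel) (by decide +kernel) (by decide +kernel)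
  obtain ⟨n6, e6⟩ := sub_sum V SS3 SS3neg [1, 0, 2, 0, 0, 0, 0, 0, 3, 0, 0, 0, 0, 0]
    (by decide +kernel) (by decide +kernel) (by decide +kernel) (by decide +kernel)
  obtain ⟨n7, e7⟩ := sub_sum V SA4 [] [1, 3, 8, 0, 0, 0, 0, 0, 0, 0, 0, 0, 0, 0]
    (by decide +kernel) (by decide +kernel) (by decide +kernel) (by decide +kernel)
  obtain ⟨n8, e8⟩ := sub_sum V SA4b [] [1, 3, 0, 8, 0, 0, 0, 0, 0, 0, 0, 0, 0, 0]
    (by decide +kernel) (by decide +kernel) (by decide +kernel) (by decide +kernel)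
  obtain ⟨n9, e9⟩ := sub_sum V SB [] [1, 9, 4, 4, 18, 0, 0, 0, 0, 0, 0, 0, 0, 0]
    (by decide +kernel) (by decide +kernel) (by decide +kernel) (by decide +kernel)
  simp [Finset.sum_range_succ, SC2, SC3a, SC3b, SC4, SS3, SA4, SA4b, SB, h0]
    at e1 e2 e3 e4 e5 e6 e7 e8 e9 hG3
  generalize V.character (rep 1) = A at *
  generalize V.character (rep 2) = B at *
  generalize V.character (rep 3) = C at *
  generalize V.character (rep 4) = D at *
  have z2 : (n1 : ℤ) + n2 = 8 := by
    have : (n1 : K) + n2 = 8 := by linear_combination (-1 / 2 : K) * (e1 + e2)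
    exact_mod_cast this
  have z6 : 48 - 12 * (n1 : ℤ) + 6 * n3 = 12 * n6 := by
    have : 48 - 12 * (n1 : K) + 6 * n3 = 12 * n6 := by
      linear_combination 2 * e6 + 6 * e1 - 2 * e3
    exact_mod_cast this
  have z7 : 6 * (n1 : ℤ) + 12 * n3 - 48 = 12 * n7 := by
    have : 6 * (n1 : K) + 12 * n3 - 48 = 12 * n7 := by
      linear_combination e7 - 3 * e1 - 4 * e3
    exact_mod_cast this
  have z8 : 6 * (n1 : ℤ) + 12 * n4 - 48 = 12 * n8 := by
    have : 6 * (n1 : K) + 12 * n4 - 48 = 12 * n8 := by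
      linear_combination e8 - 3 * e1 - 4 * e4
    exact_mod_cast this
  have z9 : 36 * (n5 : ℤ) + 6 * n3 + 6 * n4 - 96 = 36 * n9 := by
    have : 36 * (n5 : K) + 6 * n3 + 6 * n4 - 96 = 36 * n9 := by
      linear_combination e9 - 9 * e5 - 2 * e3 - 2 * e4
    exact_mod_cast this
  have zG : 180 * (n5 : ℤ) + 60 * n3 + 60 * n4 - 600 = 0 := by
    have : 180 * (n5 : K) + 60 * n3 + 60 * n4 - 600 = 0 := by
      linear_combination hG3 - 45 * e5 - 20 * e3 - 20 * e4 - 72 * h56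
    exact_mod_cast this
  have w1 : n1 = 4 := by omega
  have w3 : n3 = 2 := by omega
  have w4 : n4 = 2 := by omega
  have w5 : n5 = 2 := by omega
  subst w1 w3 w4 w5
  push_cast at e1 e3 e4 e5
  refine ⟨?_, ?_, ?_, ?_⟩
  · linear_combination e1
  · linear_combination (1 / 2 : K) * e3
  · linear_combination (1 / 2 : K) * e4
  · linear_combination (1 / 2 : K) * (e5 - e1)

end A6Char

set_option maxHeartbeats 2000000 in
/-- The values `(1 − √5)/2` and `(1 + √5)/2` of `χ₄` on the two classes of
5-cycles are expressed as `-(ζ₅ + ζ₅⁴)` and `-(ζ₅² + ζ₅³)` in terms of the same primitive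
5th root of unity `ζ₅` used to define `σ` (for `ζ₅ = e^{2πi/5}` these are literally
`(1 − √5)/2` and `(1 + √5)/2`). -/
theorem stmt11
    (K : Type) [Field K] [Algebra ℚ K] [IsCyclotomicExtension {15} ℚ K]
    (ζ₃ : K) (hζ₃ : IsPrimitiveRoot ζ₃ 3) (ζ₅ : K) (hζ₅ : IsPrimitiveRoot ζ₅ 5)
    -- H = ⟨(1,2,3), (4,5,6)⟩ ≅ (ℤ/3ℤ)²
    (u₁ u₂ : A6)
    (hu₁ : (u₁ : Equiv.Perm (Fin 7)) = c[(1 : Fin 7), 2, 3])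
    (hu₂ : (u₂ : Equiv.Perm (Fin 7)) = c[(4 : Fin 7), 5, 6])
    (hHiso : Nonempty ((Subgroup.closure {u₁, u₂} : Subgroup A6) ≃*
      (Multiplicative (ZMod 3) × Multiplicative (ZMod 3))))
    -- C₅ = ⟨(1,2,3,4,5)⟩
    (w : A6) (hw : (w : Equiv.Perm (Fin 7)) = c[(1 : Fin 7), 2, 3, 4, 5])
    -- ψ₂ : ψ₂((1,2,3)) = 1, ψ₂((4,5,6)) = ζ₃
    (ψ₂ : (Subgroup.closure {u₁, u₂} : Subgroup A6) →* K)
    (hψ₂u₁ : ψ₂ ⟨u₁, Subgroup.subset_closure (Set.mem_insert _ _)⟩ = 1)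
    (hψ₂u₂ : ψ₂ ⟨u₂, Subgroup.subset_closure (Set.mem_insert_of_mem _ rfl)⟩ = ζ₃)
    -- ψ₅ : ψ₅((1,2,3)) = ζ₃, ψ₅((4,5,6)) = ζ₃
    (ψ₅ : (Subgroup.closure {u₁, u₂} : Subgroup A6) →* K)
    (hψ₅u₁ : ψ₅ ⟨u₁, Subgroup.subset_closure (Set.mem_insert _ _)⟩ = ζ₃)
    (hψ₅u₂ : ψ₅ ⟨u₂, Subgroup.subset_closure (Set.mem_insert_of_mem _ rfl)⟩ = ζ₃)
    -- σ : σ((1,2,3,4,5)) = ζ₅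
    (σ : (Subgroup.zpowers w : Subgroup A6) →* K)
    (hσ : σ ⟨w, Subgroup.mem_zpowers w⟩ = ζ₅)
    -- χ₄ : the degree-8 irreducible character with χ₄((1,2,3,4,5)) = (1−√5)/2 and
    -- χ₄((1,3,4,5,2)) = (1+√5)/2
    (V : FDRep K A6) (hV : CategoryTheory.Simple V) (hdim : Module.finrank K V = 8)
    (w' : A6) (hw' : (w' : Equiv.Perm (Fin 7)) = c[(1 : Fin 7), 3, 4, 5, 2])
    (hval : V.character w = -(ζ₅ + ζ₅ ^ 4))
    (hval' : V.character w' = -(ζ₅ ^ 2 + ζ₅ ^ 3)) :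
    ∀ g : A6, indChar (Subgroup.closure {u₁, u₂}) ψ₂ g +
        indChar (Subgroup.closure {u₁, u₂}) ψ₅ g - indChar (Subgroup.zpowers w) σ g =
      V.character g := by
  have hchar : CharZero K := algebraRat.charZero K
  have hcu₁ : A6Char.code u₁ = 1753808 := by
    unfold A6Char.code; rw [hu₁]; decide +kernel
  have hcu₂ : A6Char.code u₂ = 1267336 := by
    unfold A6Char.code; rw [hu₂]; decide +kernel
  have hcw : A6Char.code w = 1628368 := by
    unfold A6Char.code; rw [hw]; decide +kernel
  have hcw' : A6Char.code w' = 1661016 := by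
    unfold A6Char.code; rw [hw']; decide +kernel
  have h3 : ζ₃ ^ 3 = 1 := hζ₃.pow_eq_one
  have h5 : ζ₅ ^ 5 = 1 := hζ₅.pow_eq_one
  have s3 : 1 + ζ₃ + ζ₃ ^ 2 = 0 := by
    have := hζ₃.geom_sum_eq_zero (by norm_num)
    simpa [Finset.sum_range_succ] using this
  have s5 : 1 + ζ₅ + ζ₅ ^ 2 + ζ₅ ^ 3 + ζ₅ ^ 4 = 0 := by
    have := hζ₅.geom_sum_eq_zero (by norm_num)
    simpa [Finset.sum_range_succ] using this
  -- the characters on codes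
  have v2 := A6Char.hom_val (Subgroup.closure {u₁, u₂}) {u₁, u₂} rfl A6Char.HL A6Char.e2 3 ζ₃ h3 ψ₂
    (by
      rintro t ht (rfl | rfl)
      · rw [hcu₁]; exact ⟨by decide +kernel, hψ₂u₁.trans (pow_zero _).symm⟩
      · rw [hcu₂]; exact ⟨by decide +kernel, hψ₂u₂.trans (pow_one _).symm⟩) (by decide +kernel)
  have v5 := A6Char.hom_val (Subgroup.closure {u₁, u₂}) {u₁, u₂} rfl A6Char.HL A6Char.e5 3 ζ₃ h3 ψ₅
    (by
      rintro t ht (rfl | rfl)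
      · rw [hcu₁]; exact ⟨by decide +kernel, hψ₅u₁.trans (pow_one _).symm⟩
      · rw [hcu₂]; exact ⟨by decide +kernel, hψ₅u₂.trans (pow_one _).symm⟩) (by decide +kernel)
  have vs := A6Char.hom_val (Subgroup.zpowers w) {w} (Subgroup.zpowers_eq_closure w)
    A6Char.CL A6Char.es 5 ζ₅ h5 σ
    (by
      rintro t ht rfl
      rw [hcw]; exact ⟨by decide +kernel, hσ.trans (pow_one _).symm⟩) (by decide +kernel)
  have mH : ∀ h, h ∈ (Subgroup.closure {u₁, u₂} : Subgroup A6) ↔ A6Char.code h ∈ A6Char.HL := by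
    intro h
    refine ⟨fun hh => (v2 h hh).1, fun hh => ?_⟩
    have := List.all_eq_true.1 A6Char.HL_words _ hh
    simp only [List.any_eq_true, Nat.beq_eq] at this
    obtain ⟨i, _, j, _, hij⟩ := this
    rw [← hcu₁, ← hcu₂, ← A6Char.code_pow, ← A6Char.code_pow, ← A6Char.code_mul] at hij
    rw [A6Char.code_inj hij]
    have m1 : u₁ ∈ (Subgroup.closure {u₁, u₂} : Subgroup A6) :=
      Subgroup.subset_closure (Set.mem_insert u₁ {u₂})
    have m2 : u₂ ∈ (Subgroup.closure {u₁, u₂} : Subgroup A6) :=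
      Subgroup.subset_closure (Set.mem_insert_of_mem u₁ (Set.mem_singleton u₂))
    exact Subgroup.mul_mem _ (Subgroup.pow_mem _ m1 i) (Subgroup.pow_mem _ m2 j)
  have mC : ∀ h, h ∈ (Subgroup.zpowers w : Subgroup A6) ↔ A6Char.code h ∈ A6Char.CL := by
    intro h
    refine ⟨fun hh => (vs h hh).1, fun hh => ?_⟩
    have := List.all_eq_true.1 A6Char.CL_words _ hh
    simp only [List.any_eq_true, Nat.beq_eq] at this
    obtain ⟨i, _, hij⟩ := this
    rw [← hcw, ← A6Char.code_pow] at hij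
    rw [A6Char.code_inj hij]
    exact pow_mem (Subgroup.mem_zpowers w) _
  have cH : Nat.card (Subgroup.closure {u₁, u₂} : Subgroup A6) = 9 := by
    obtain ⟨φ⟩ := hHiso
    rw [Nat.card_congr φ.toEquiv, Nat.card_prod]
    simp
  have cC : Nat.card (Subgroup.zpowers w : Subgroup A6) = 5 := by
    rw [Nat.card_zpowers]
    have : Fact (Nat.Prime 5) := ⟨by norm_num⟩
    refine orderOf_eq_prime (A6Char.code_inj ?_) fun h => ?_
    · rw [A6Char.code_pow, hcw]; decide +kernel
    · rw [h, A6Char.code_one] at hcw; omega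
  have I2 := A6Char.indChar_rep (Subgroup.closure {u₁, u₂}) ψ₂ A6Char.HL 3 (by norm_num) A6Char.e2
    ζ₃ h3 mH (fun h hh => (v2 h hh).2)
  have I5 := A6Char.indChar_rep (Subgroup.closure {u₁, u₂}) ψ₅ A6Char.HL 3 (by norm_num) A6Char.e5
    ζ₃ h3 mH (fun h hh => (v5 h hh).2)
  have Is := A6Char.indChar_rep (Subgroup.zpowers w) σ A6Char.CL 5 (by norm_num) A6Char.es
    ζ₅ h5 mC (fun h hh => (vs h hh).2)
  rw [cH] at I2 I5
  rw [cC] at Is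
  -- the values of the irreducible character
  have r5 : A6Char.rep 5 = w := A6Char.code_inj (by rw [A6Char.code_rep, hcw]; rfl)
  have r6 : A6Char.rep 6 = w' := A6Char.code_inj (by rw [A6Char.code_rep, hcw']; rfl)
  have x0 : V.character (A6Char.rep 0) = 8 := by
    have r0 : A6Char.rep 0 = 1 := A6Char.code_inj (by rw [A6Char.code_rep, A6Char.code_one]; rfl)
    rw [r0, FDRep.char_one, hdim]; norm_num
  have x5 : V.character (A6Char.rep 5) = -(ζ₅ + ζ₅ ^ 4) := by rw [r5, hval]
  have x6 : V.character (A6Char.rep 6) = -(ζ₅ ^ 2 + ζ₅ ^ 3) := by rw [r6, hval']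
  obtain ⟨x1, x2, x3, x4⟩ := A6Char.char_values V hV x0
    (by rw [x5, x6]; linear_combination -s5)
  intro g
  rw [A6Char.classFun_eq (indChar (Subgroup.closure {u₁, u₂}) ψ₂)
      (fun x g => A6Char.indChar_conj _ _ x g) g,
    A6Char.classFun_eq (indChar (Subgroup.closure {u₁, u₂}) ψ₅)
      (fun x g => A6Char.indChar_conj _ _ x g) g,
    A6Char.classFun_eq (indChar (Subgroup.zpowers w) σ)
      (fun x g => A6Char.indChar_conj _ _ x g) g,
    A6Char.classFun_eq V.character (fun x g => FDRep.char_conj V g x) g]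
  have hlt := A6Char.cls_lt (A6Char.code g)
  generalize A6Char.cls (A6Char.code g) = k at hlt ⊢
  interval_cases k
  · rw [I2 0 [360, 0, 0, 0] (by decide +kernel), I5 0 [360, 0, 0, 0] (by decide +kernel),
      Is 0 [360, 0, 0, 0, 0, 0] (by decide +kernel), x0]
    simp [Finset.sum_range_succ]
    norm_num
  · rw [I2 1 [0, 0, 0, 360] (by decide +kernel), I5 1 [0, 0, 0, 360] (by decide +kernel),
      Is 1 [0, 0, 0, 0, 0, 360] (by decide +kernel), x1]
    simp [Finset.sum_range_succ]
  · rw [I2 2 [18, 9, 9, 324] (by decide +kernel), I5 2 [0, 18, 18, 324] (by decide +kernel),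
      Is 2 [0, 0, 0, 0, 0, 360] (by decide +kernel), x2]
    simp [Finset.sum_range_succ]
    linear_combination (3 : K) * s3
  · rw [I2 3 [0, 18, 18, 324] (by decide +kernel), I5 3 [18, 9, 9, 324] (by decide +kernel),
      Is 3 [0, 0, 0, 0, 0, 360] (by decide +kernel), x3]
    simp [Finset.sum_range_succ]
    linear_combination (3 : K) * s3
  · rw [I2 4 [0, 0, 0, 360] (by decide +kernel), I5 4 [0, 0, 0, 360] (by decide +kernel),
      Is 4 [0, 0, 0, 0, 0, 360] (by decide +kernel), x4]
    simp [Finset.sum_range_succ]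
  · rw [I2 5 [0, 0, 0, 360] (by decide +kernel), I5 5 [0, 0, 0, 360] (by decide +kernel),
      Is 5 [0, 5, 0, 0, 5, 350] (by decide +kernel), x5]
    simp [Finset.sum_range_succ]
    ring
  · rw [I2 6 [0, 0, 0, 360] (by decide +kernel), I5 6 [0, 0, 0, 360] (by decide +kernel),
      Is 6 [0, 0, 5, 5, 0, 350] (by decide +kernel), x6]
    simp [Finset.sum_range_succ]
    ring
end

section
/- Let G be the simple group PSL(2,8) of order 504, acting as 2×2 matrices over 𝔽₈ = 𝔽₂(a) modulo scalars. Let C₂³ = ⟨s, t, u⟩ with s = [[0,a⁵],[a²,0]], t = [[a⁵,a²],[a⁶,a⁵]], u = [[a,a],[a⁵,a]], an elementary abelian group of order 8, and let χ be its degree-1 character with χ(s) = −1, χ(t) = χ(u) = 1. Let C₉ = ⟨h⟩ with h = [[a⁴,1],[1,0]], and let ρ be the degree-1 character of C₉ with ρ(h) = ζ₃². Then Ind_{C₂³}^G(χ) − Ind_{C₉}^G(ρ) equals the irreducible character χ₂ of G of degree 7 that takes value −2 on elements of order 3 and value 1 on all elements of order 9. -/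
open scoped Classical

/-- The field `𝔽₈`. -/
abbrev F8 := GaloisField 2 3

/-- `SL(2,8)`. -/
abbrev SL28 := Matrix.SpecialLinearGroup (Fin 2) F8

/-- `PSL(2,8) = SL(2,8)` modulo scalars (the center). -/
abbrev PSL28 := SL28 ⧸ Subgroup.center SL28

noncomputable instance : Fintype PSL28 := Fintype.ofFinite _


/-! ### A computable model of the field with eight elements -/

/-- Coordinates with respect to the basis `1, a, a²`. -/
abbrev M8 := ZMod 2 × ZMod 2 × ZMod 2

/-- Multiplication in coordinates, using `a³ = a + 1`. -/
def mulM (x y : M8) : M8 :=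
  (x.1 * y.1 + x.2.1 * y.2.2 + x.2.2 * y.2.1,
   x.1 * y.2.1 + x.2.1 * y.1 + x.2.1 * y.2.2 + x.2.2 * y.2.1 + x.2.2 * y.2.2,
   x.1 * y.2.2 + x.2.1 * y.2.1 + x.2.2 * y.1 + x.2.2 * y.2.2)

/-- The element with given coordinates. -/
noncomputable def phi (a : F8) (x : M8) : F8 :=
  algebraMap (ZMod 2) F8 x.1 + algebraMap (ZMod 2) F8 x.2.1 * a +
    algebraMap (ZMod 2) F8 x.2.2 * a ^ 2

lemma two_F8 : (2 : F8) = 0 := by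
  have := CharP.cast_eq_zero F8 2
  exact_mod_cast this

lemma phi_add (a : F8) (x y : M8) : phi a (x + y) = phi a x + phi a y := by
  simp only [phi, Prod.fst_add, Prod.snd_add, map_add]; ring

lemma phi_mul (a : F8) (ha : a ^ 3 = a + 1) (x y : M8) :
    phi a (mulM x y) = phi a x * phi a y := by
  simp only [phi, mulM, map_add, map_mul]
  generalize algebraMap (ZMod 2) F8 x.1 = x0
  generalize algebraMap (ZMod 2) F8 x.2.1 = x1
  generalize algebraMap (ZMod 2) F8 x.2.2 = x2
  generalize algebraMap (ZMod 2) F8 y.1 = y0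
  generalize algebraMap (ZMod 2) F8 y.2.1 = y1
  generalize algebraMap (ZMod 2) F8 y.2.2 = y2
  linear_combination (-(x1 * y2 + x2 * y1) - x2 * y2 * a) * ha

lemma phi_one (a : F8) : phi a (1, 0, 0) = 1 := by simp [phi]
lemma phi_zero (a : F8) : phi a 0 = 0 := by simp [phi]

lemma inv_M8 : ∀ x : M8, x ≠ 0 → ∃ y, mulM x y = (1, 0, 0) := by decide +kernel

lemma phi_inj (a : F8) (ha : a ^ 3 = a + 1) : Function.Injective (phi a) := by
  have key : ∀ x, phi a x = 0 → x = 0 := by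
    intro x hx
    by_contra h
    obtain ⟨y, hy⟩ := inv_M8 x h
    have := phi_mul a ha x y
    rw [hy, phi_one, hx] at this
    simp at this
  intro x y h
  have h2 : x + y = 0 := key _ (by rw [phi_add, h]; linear_combination phi a y * two_F8)
  have : ∀ x y : M8, x + y = 0 → x = y := by decide +kernel
  exact this _ _ h2

lemma card_F8 : Nat.card F8 = 8 := by
  rw [GaloisField.card 2 3 (by norm_num)]; norm_num

lemma phi_bij (a : F8) (ha : a ^ 3 = a + 1) : Function.Bijective (phi a) := by
  rw [Nat.bijective_iff_injective_and_card]
  refine ⟨phi_inj a ha, ?_⟩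
  rw [card_F8, Nat.card_eq_fintype_card]
  rfl

lemma pow8 (x : F8) : x ^ 8 = x := by
  have : Fintype F8 := Fintype.ofFinite _
  have h := FiniteField.pow_card x
  rwa [← Nat.card_eq_fintype_card, card_F8] at h

lemma F8_cases (x : F8) : x = 0 ∨ x = 1 ∨ x ^ 3 + x + 1 = 0 ∨ x ^ 3 + x ^ 2 + 1 = 0 := by
  have h := pow8 x
  have : x * ((x - 1) * ((x ^ 3 + x + 1) * (x ^ 3 + x ^ 2 + 1))) = 0 := by
    linear_combination h + (x ^ 5 - x ^ 4) * two_F8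
  simpa [sub_eq_zero] using this

/-! ### Counting -/

/-- the trace -/
noncomputable def tr (g : SL28) : F8 := g.1 0 0 + g.1 1 1

lemma det_eq (g : SL28) : g.1 0 0 * g.1 1 1 + g.1 0 1 * g.1 1 0 = 1 := by
  have := g.2
  rw [Matrix.det_fin_two] at this
  linear_combination this + g.1 0 1 * g.1 1 0 * two_F8

/-- Matrices of determinant one in the model. -/
def cnt (P : M8 → Bool) : ℕ :=
  Fintype.card {m : (M8 × M8) × (M8 × M8) //
    (mulM m.1.1 m.2.2 + mulM m.1.2 m.2.1 == (1, 0, 0) && P (m.1.1 + m.2.2)) = true}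

lemma card_tr (a : F8) (ha : a ^ 3 = a + 1) (P : M8 → Bool) (Q : F8 → Prop)
    (hPQ : ∀ x, P x = true ↔ Q (phi a x)) :
    Nat.card {g : SL28 // Q (tr g)} = cnt P := by
  unfold cnt
  rw [← Nat.card_eq_fintype_card]
  symm
  have hdet : ∀ m : (M8 × M8) × (M8 × M8), mulM m.1.1 m.2.2 + mulM m.1.2 m.2.1 = (1, 0, 0) ↔
      (!![phi a m.1.1, phi a m.1.2; phi a m.2.1, phi a m.2.2]).det = 1 := by
    intro m
    rw [Matrix.det_fin_two_of, ← phi_one a, ← (phi_inj a ha).eq_iff, phi_add, phi_mul a ha,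
      phi_mul a ha]
    rw [show ∀ x y : F8, x - y = x + y from fun x y => by linear_combination -y * two_F8]
  let F : {m : (M8 × M8) × (M8 × M8) //
    (mulM m.1.1 m.2.2 + mulM m.1.2 m.2.1 == (1, 0, 0) && P (m.1.1 + m.2.2)) = true} →
      {g : SL28 // Q (tr g)} := fun m =>
    ⟨⟨!![phi a m.1.1.1, phi a m.1.1.2; phi a m.1.2.1, phi a m.1.2.2], (hdet m.1).1 (by
      have := m.2; simp only [Bool.and_eq_true, beq_iff_eq] at this; exact this.1)⟩, by
      have := m.2; simp only [Bool.and_eq_true, beq_iff_eq] at this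
      have h2 := (hPQ _).1 this.2
      rw [phi_add] at h2
      simpa [tr] using h2⟩
  apply Nat.card_congr (Equiv.ofBijective F _)
  constructor
  · rintro ⟨⟨⟨p, q⟩, ⟨r, s⟩⟩, h1⟩ ⟨⟨⟨p', q'⟩, ⟨r', s'⟩⟩, h2⟩ h
    have h3 : !![phi a p, phi a q; phi a r, phi a s] =
      !![phi a p', phi a q'; phi a r', phi a s'] := congrArg (fun z => z.1.1) h
    have e1 := phi_inj a ha (congrFun (congrFun h3 0) 0)
    have e2 := phi_inj a ha (congrFun (congrFun h3 0) 1)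
    have e3 := phi_inj a ha (congrFun (congrFun h3 1) 0)
    have e4 := phi_inj a ha (congrFun (congrFun h3 1) 1)
    subst e1 e2 e3 e4
    rfl
  · rintro ⟨g, hg⟩
    obtain ⟨p, hp⟩ := (phi_bij a ha).2 (g.1 0 0)
    obtain ⟨q, hq⟩ := (phi_bij a ha).2 (g.1 0 1)
    obtain ⟨r, hr⟩ := (phi_bij a ha).2 (g.1 1 0)
    obtain ⟨s, hs⟩ := (phi_bij a ha).2 (g.1 1 1)
    have hm : !![phi a p, phi a q; phi a r, phi a s] = g.1 := by
      rw [hp, hq, hr, hs]; exact (Matrix.eta_fin_two g.1).symm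
    refine ⟨⟨((p, q), (r, s)), ?_⟩, ?_⟩
    · simp only [Bool.and_eq_true, beq_iff_eq]
      refine ⟨(hdet ((p, q), (r, s))).2 ?_, (hPQ _).2 ?_⟩
      · simp only [hm]; exact g.2
      · rw [phi_add, hp, hs]; exact hg
    · apply Subtype.ext; apply Subtype.ext; exact hm

/-- `x³` in the model. -/
def cubeM (x : M8) : M8 := mulM x (mulM x x)

lemma phi_cube (a : F8) (ha : a ^ 3 = a + 1) (x : M8) : phi a (cubeM x) = phi a x ^ 3 := by
  rw [cubeM, phi_mul a ha, phi_mul a ha]; ring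

lemma cnt_eq : ∀ t : M8, cnt (fun x => x == t) =
    if t = 0 then 64 else if cubeM t + mulM t t + (1, 0, 0) = 0 then 72 else 56 := by
  decide +kernel

lemma card_tr_eq (a : F8) (ha : a ^ 3 = a + 1) (t : F8) :
    Nat.card {g : SL28 // tr g = t} =
      if t = 0 then 64 else if t ^ 3 + t ^ 2 + 1 = 0 then 72 else 56 := by
  obtain ⟨m, rfl⟩ := (phi_bij a ha).2 t
  rw [card_tr a ha (fun x => x == m) (fun x => x = phi a m)
    (fun x => by simp [(phi_inj a ha).eq_iff]), cnt_eq]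
  have h1 : phi a m = 0 ↔ m = 0 := by rw [← phi_zero a, (phi_inj a ha).eq_iff]
  have h2 : phi a m ^ 3 + phi a m ^ 2 + 1 = 0 ↔ cubeM m + mulM m m + (1, 0, 0) = 0 := by
    rw [← (phi_inj a ha).eq_iff, phi_add, phi_add, phi_cube a ha, phi_mul a ha, phi_one, phi_zero,
      sq]
  simp only [h1, h2]

/-! ### The group -/

lemma center_bot (z : SL28) (hz : z ∈ Subgroup.center SL28) : z = 1 := by
  obtain ⟨r, hr, h⟩ := Matrix.SpecialLinearGroup.mem_center_iff.1 hz
  have hr2 : (r - 1) ^ 2 = 0 := by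
    have : r ^ 2 = 1 := by simpa using hr
    linear_combination this - (r - 1) * two_F8
  have : r = 1 := by
    have := pow_eq_zero_iff (two_ne_zero) |>.1 hr2
    linear_combination this
  apply Subtype.ext
  rw [← h, this]
  simp

/-- `SL(2,8)` is `PSL(2,8)`. -/
noncomputable def qe : SL28 ≃* PSL28 :=
  MulEquiv.ofBijective (QuotientGroup.mk' (Subgroup.center SL28)) ⟨by
    rw [injective_iff_map_eq_one]
    intro z hz
    exact center_bot z ((QuotientGroup.eq_one_iff z).1 hz), QuotientGroup.mk'_surjective _⟩

lemma qe_apply (x : SL28) : qe x = QuotientGroup.mk x := rfl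

lemma eq_one_of (g : SL28) (h01 : g.1 0 1 = 0) (h10 : g.1 1 0 = 0) (h : tr g = 0) : g = 1 := by
  have hd := det_eq g
  have ht : g.1 0 0 + g.1 1 1 = 0 := h
  have h2 : (g.1 0 0 - 1) ^ 2 = 0 := by
    rw [h01] at hd
    linear_combination -hd + g.1 0 0 * ht - g.1 0 0 * two_F8
  have h3 : g.1 0 0 = 1 := by
    have := pow_eq_zero_iff (two_ne_zero) |>.1 h2
    linear_combination this
  have h4 : g.1 1 1 = 1 := by linear_combination ht - h3 - two_F8
  apply Subtype.ext
  rw [Matrix.eta_fin_two g.1, h01, h10, h3, h4, Matrix.SpecialLinearGroup.coe_one,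
    Matrix.one_fin_two]

/-- companion matrix -/
noncomputable def comp (t : F8) : SL28 := ⟨!![0, 1; 1, t], by
  rw [Matrix.det_fin_two_of]; linear_combination -two_F8⟩

lemma conj_comp_aux (g : SL28) (X : Matrix (Fin 2) (Fin 2) F8) (hX : X.det ≠ 0)
    (h : g.1 * X = X * (comp (tr g)).1) : ∃ x : SL28, g * x = x * comp (tr g) := by
  refine ⟨⟨(X.det) ^ 3 • X, ?_⟩, ?_⟩
  · rw [Matrix.det_smul, Fintype.card_fin]
    have h8 := pow8 X.det
    have : X.det * (X.det ^ 7 - 1) = 0 := by linear_combination h8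
    have := (mul_eq_zero.1 this).resolve_left hX
    linear_combination this
  · apply Subtype.ext
    change g.1 * (X.det ^ 3 • X) = (X.det ^ 3 • X) * (comp (tr g)).1
    rw [Matrix.mul_smul, h, Matrix.smul_mul]

lemma conj_comp (g : SL28) (hg : g ≠ 1) : ∃ x : SL28, g * x = x * comp (tr g) := by
  have hd := det_eq g
  have key : ∀ v w : F8, (!![v, g.1 0 0 * v + g.1 0 1 * w; w, g.1 1 0 * v + g.1 1 1 * w]).det ≠ 0 →
      ∃ x : SL28, g * x = x * comp (tr g) := by
    intro v w h
    refine conj_comp_aux g _ h ?_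
    ext i j
    fin_cases i <;> fin_cases j <;>
      simp [comp, tr, Matrix.mul_apply, Fin.sum_univ_two]
    · linear_combination (-v) * hd + (g.1 0 1 * g.1 1 0 * v - v) * two_F8
    · linear_combination (-w) * hd + (g.1 0 1 * g.1 1 0 * w - w) * two_F8
  by_cases h10 : g.1 1 0 = 0
  · by_cases h01 : g.1 0 1 = 0
    · refine key 1 1 ?_
      rw [Matrix.det_fin_two_of]
      intro h
      apply hg
      apply eq_one_of g h01 h10
      rw [h01, h10] at h
      unfold tr
      linear_combination h + g.1 0 0 * two_F8
    · refine key 0 1 ?_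
      rw [Matrix.det_fin_two_of]
      simpa using h01
  · refine key 1 0 ?_
    rw [Matrix.det_fin_two_of]
    simpa using h10

lemma conj_of_tr (g g' : SL28) (hg : g ≠ 1) (hg' : g' ≠ 1) (h : tr g = tr g') :
    ∃ x : SL28, g' = x * g * x⁻¹ := by
  obtain ⟨x, hx⟩ := conj_comp g hg
  obtain ⟨y, hy⟩ := conj_comp g' hg'
  refine ⟨y * x⁻¹, ?_⟩
  rw [← h] at hy
  have h1 : comp (tr g) = x⁻¹ * g * x := by rw [mul_assoc, hx]; group
  have h2 : g' = y * comp (tr g) * y⁻¹ := by rw [← hy]; group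
  rw [h2, h1]; group

lemma tr_conj (g x : SL28) : tr (x * g * x⁻¹) = tr g := by
  have : ∀ z : SL28, tr z = z.1.trace := fun z => by rw [Matrix.trace_fin_two]; rfl
  rw [this, this, Matrix.SpecialLinearGroup.coe_mul, Matrix.trace_mul_comm,
    ← Matrix.SpecialLinearGroup.coe_mul]
  congr 2
  rw [← mul_assoc, inv_mul_cancel, one_mul]

lemma tr_one : tr 1 = 0 := by
  simp [tr]; linear_combination two_F8

lemma cayley (g : SL28) : g.1 * g.1 = tr g • g.1 + 1 := by
  have hd := det_eq g
  ext i j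
  fin_cases i <;> fin_cases j <;> simp [tr, Matrix.mul_apply, Fin.sum_univ_two]
  · linear_combination (-1 : F8) * hd + (g.1 0 1 * g.1 1 0 - 1) * two_F8
  · ring
  · ring
  · linear_combination (-1 : F8) * hd + (g.1 0 1 * g.1 1 0 - 1) * two_F8

lemma tr_rec (g : SL28) (n : ℕ) : tr (g ^ (n + 2)) = tr g * tr (g ^ (n + 1)) + tr (g ^ n) := by
  have h : (g ^ (n + 2)).1 = tr g • (g ^ (n + 1)).1 + (g ^ n).1 := by
    simp only [Matrix.SpecialLinearGroup.coe_pow]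
    rw [pow_add, pow_two, cayley g, pow_succ, mul_add, Matrix.mul_smul, mul_one]
  unfold tr at h ⊢
  rw [h]; simp; ring

lemma tr_sq (g : SL28) : tr (g ^ 2) = tr g ^ 2 := by
  have := tr_rec g 0
  simp only [zero_add, pow_one, pow_zero, tr_one] at this
  rw [this]; ring

lemma tr_three (g : SL28) : tr (g ^ 3) = tr g ^ 3 + tr g := by
  have := tr_rec g 1
  simp only [pow_one] at this
  rw [this, tr_sq]; ring

lemma SL_sq_eq_one (g : SL28) (h : tr g = 0) : g ^ 2 = 1 := by
  apply Subtype.ext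
  rw [Matrix.SpecialLinearGroup.coe_pow, pow_two, cayley, h]; simp

lemma tr_eq_zero (g : SL28) (h : g ^ 2 = 1) : tr g = 0 := by
  have h1 := tr_sq g
  rw [h, tr_one] at h1
  exact pow_eq_zero_iff (two_ne_zero) |>.1 h1.symm

lemma cube_eq (g : SL28) : (g ^ 3).1 = (tr g ^ 2 + 1) • g.1 + tr g • 1 := by
  rw [Matrix.SpecialLinearGroup.coe_pow, pow_succ, pow_two, cayley, add_mul, Matrix.smul_mul,
    cayley, one_mul]
  module

lemma cube_eq_one (g : SL28) (h : tr g = 1) : g ^ 3 = 1 := by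
  apply Subtype.ext
  rw [cube_eq, h]
  rw [show (1 : F8) ^ 2 + 1 = 0 by linear_combination two_F8]; simp

lemma order_three (g : SL28) (h : tr g = 1) : orderOf g = 3 := by
  have : Fact (Nat.Prime 3) := ⟨by norm_num⟩
  apply orderOf_eq_prime (cube_eq_one g h)
  rintro rfl
  rw [tr_one] at h
  exact zero_ne_one h

lemma order_nine (g : SL28) (h : tr g ^ 3 + tr g + 1 = 0) : orderOf g = 9 := by
  have h3 : tr (g ^ 3) = 1 := by rw [tr_three]; linear_combination h - two_F8
  have h9 : (g ^ 3) ^ 3 = 1 := cube_eq_one _ h3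
  have : Fact (Nat.Prime 3) := ⟨by norm_num⟩
  refine orderOf_eq_prime_pow (p := 3) (n := 1) ?_ ?_
  · intro h1
    rw [pow_one] at h1
    rw [h1, tr_one] at h3
    exact zero_ne_one h3
  · rw [← h9, ← pow_mul]; norm_num

lemma pow_seven (g : SL28) (h : tr g ^ 3 + tr g ^ 2 + 1 = 0) : g ^ 7 = 1 := by
  have h2 := cube_eq g
  have hA : (tr g ^ 2 + 1) ^ 3 + 2 * (tr g ^ 2 + 1) * tr g * tr g + tr g ^ 2 = 0 := by
    linear_combination (tr g ^ 3 + tr g ^ 2 + 1) * h +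
      (2 * tr g ^ 4 - tr g ^ 5 - tr g ^ 3 + 2 * tr g ^ 2) * two_F8
  have hB : (tr g ^ 2 + 1) ^ 2 * tr g + 2 * (tr g ^ 2 + 1) * tr g = 1 := by
    linear_combination (tr g ^ 2 + tr g + 1) * h +
      (tr g ^ 3 - tr g ^ 4 - tr g ^ 2 + tr g - 1) * two_F8
  have hc : g.1 * g.1 * g.1 = (tr g ^ 2 + 1) • g.1 + tr g • 1 := by
    rw [← h2, Matrix.SpecialLinearGroup.coe_pow, pow_succ, pow_two]
  have hg : (g ^ 7).1 = ((tr g ^ 2 + 1) ^ 3 + 2 * (tr g ^ 2 + 1) * tr g * tr g + tr g ^ 2) • g.1 +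
      ((tr g ^ 2 + 1) ^ 2 * tr g + 2 * (tr g ^ 2 + 1) * tr g) • 1 := by
    rw [show 7 = 3 + 3 + 1 from rfl, pow_succ, pow_add, Matrix.SpecialLinearGroup.coe_mul,
      Matrix.SpecialLinearGroup.coe_mul, h2]
    generalize tr g ^ 2 + 1 = c at *
    simp only [add_mul, mul_add, Matrix.smul_mul, Matrix.mul_smul, one_mul, mul_one, hc]
    rw [cayley]
    module
  apply Subtype.ext
  rw [hg, hA, hB]; simp

/-! ### Linear algebra and representations -/

open Polynomial in
lemma cyclotomic_seven_irreducible (K : Type) [Field K] [Algebra ℚ K]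
    [IsCyclotomicExtension {3} ℚ K] : Irreducible (cyclotomic 7 K) := by
  have : CharZero K := algebraRat.charZero K
  have hfr : Module.finrank ℚ K = 2 := by
    rw [IsCyclotomicExtension.finrank (n := 3) K (cyclotomic.irreducible_rat (by norm_num))]
    decide
  have : FiniteDimensional ℚ K := Module.finite_of_finrank_pos (by omega)
  let L := AlgebraicClosure K
  have : CharZero L := algebraRat.charZero L
  have : NeZero ((7 : ℕ) : L) := ⟨by norm_num⟩
  obtain ⟨η, hη⟩ := HasEnoughRootsOfUnity.exists_primitiveRoot L 7
  have hζ := (IsCyclotomicExtension.zeta_spec 3 ℚ K).map_of_injective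
    (f := algebraMap K L) (algebraMap K L).injective
  set ω := algebraMap K L (IsCyclotomicExtension.zeta 3 ℚ K) with hω
  have h21 : IsPrimitiveRoot (ω * η) 21 := by
    rw [IsPrimitiveRoot.iff_orderOf, (Commute.all _ _).orderOf_mul_eq_mul_orderOf_of_coprime]
    · rw [← hζ.eq_orderOf, ← hη.eq_orderOf]
    · rw [← hζ.eq_orderOf, ← hη.eq_orderOf]; norm_num
  have hint : IsIntegral K η := hη.isIntegral (by norm_num) |>.tower_top
  have hmem : ω * η ∈ IntermediateField.adjoin K {η} :=
    mul_mem (IntermediateField.algebraMap_mem _ _) (IntermediateField.mem_adjoin_simple_self K η)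
  have : FiniteDimensional K (IntermediateField.adjoin K {η}) :=
    IntermediateField.adjoin.finiteDimensional hint
  have hd : Module.finrank ℚ (IntermediateField.adjoin K {η}) = 2 * (minpoly K η).natDegree := by
    rw [← Module.finrank_mul_finrank ℚ K, hfr, IntermediateField.adjoin.finrank hint]
  have : FiniteDimensional ℚ (IntermediateField.adjoin K {η}) := Module.Finite.trans K _
  have h12 : 12 ≤ Module.finrank ℚ (IntermediateField.adjoin K {η}) := by
    have h1 := minpoly.natDegree_le (A := ℚ) (⟨ω * η, hmem⟩ : IntermediateField.adjoin K {η})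
    have h2 : minpoly ℚ (⟨ω * η, hmem⟩ : IntermediateField.adjoin K {η}) = minpoly ℚ (ω * η) :=
      (minpoly.algebraMap_eq (A := ℚ) (algebraMap (IntermediateField.adjoin K {η}) L).injective
        ⟨ω * η, hmem⟩).symm
    rw [h2, ← cyclotomic_eq_minpoly_rat h21 (by norm_num), natDegree_cyclotomic] at h1
    exact le_trans (by decide) h1
  have hdvd : minpoly K η ∣ cyclotomic 7 K := by
    apply minpoly.dvd
    rw [aeval_def, eval₂_eq_eval_map, map_cyclotomic]
    exact hη.isRoot_cyclotomic (by norm_num)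
  have heq : cyclotomic 7 K = minpoly K η := by
    apply eq_of_monic_of_dvd_of_natDegree_le (minpoly.monic hint) (cyclotomic.monic 7 K) hdvd
    rw [natDegree_cyclotomic, show Nat.totient 7 = 6 by decide]
    omega
  rw [heq]
  exact minpoly.irreducible hint

open Polynomial in
lemma trace_order_seven {K : Type} [Field K] [CharZero K] (hirr : Irreducible (cyclotomic 7 K))
    {V : Type} [AddCommGroup V] [Module K V] [FiniteDimensional K V]
    (hd : Module.finrank K V = 7) (f : Module.End K V) (hf : f ^ 7 = 1) :
    f = 1 ∨ LinearMap.trace K V f = 0 := by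
  have hfac : (X - 1) * cyclotomic 7 K = X ^ 7 - 1 := by
    have : Fact (Nat.Prime 7) := ⟨by norm_num⟩
    rw [mul_comm]; exact cyclotomic_prime_mul_X_sub_one K 7
  have hdvd : minpoly K f ∣ (X - 1) * cyclotomic 7 K := by
    rw [hfac]; apply minpoly.dvd; simp [hf]
  rcases (em (cyclotomic 7 K ∣ minpoly K f)).symm with hc | hc
  · left
    have := ((Irreducible.coprime_iff_not_dvd hirr).2 hc).symm.dvd_of_dvd_mul_right hdvd
    have h := aeval_eq_zero_of_dvd_aeval_eq_zero this (minpoly.aeval K f)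
    simpa [sub_eq_zero] using h
  · right
    obtain ⟨q, hq⟩ := hc.trans (LinearMap.minpoly_dvd_charpoly f)
    have hm : f.charpoly.Monic := f.charpoly_monic
    have hdeg : f.charpoly.natDegree = 7 := by rw [LinearMap.charpoly_natDegree, hd]
    have hcm : (cyclotomic 7 K).Monic := cyclotomic.monic 7 K
    have hqm : q.Monic := hcm.of_mul_monic_left (hq ▸ hm)
    have hqd : q.natDegree = 1 := by
      have := hcm.natDegree_mul hqm
      rw [← hq, hdeg, natDegree_cyclotomic, show Nat.totient 7 = 6 by decide] at this
      omega
    have hq1 : q = X + C (q.coeff 0) := by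
      exact hqm.eq_X_add_C hqd
    set c := q.coeff 0
    have hroot : f.charpoly.IsRoot (-c) := by rw [hq, hq1]; simp
    have hev := (Module.End.hasEigenvalue_iff_isRoot_charpoly f (-c)).2 hroot
    have hc7 : (-c) ^ 7 = 1 := by
      obtain ⟨v, hv⟩ := hev.exists_hasEigenvector
      have := hv.pow_apply 7
      rw [hf, Module.End.one_apply] at this
      have h2 : ((-c) ^ 7 - 1) • v = 0 := by rw [sub_smul, one_smul, ← this, sub_self]
      exact sub_eq_zero.1 ((smul_eq_zero.1 h2).resolve_right hv.2)
    have hc1 : -c = 1 := by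
      have h1 : ((X - 1) * cyclotomic 7 K).IsRoot (-c) := by
        rw [hfac]; simp [hc7]
      rw [root_mul] at h1
      rcases h1 with h1 | h1
      · simpa [sub_eq_zero] using h1
      · exfalso
        have := degree_eq_one_of_irreducible_of_root hirr h1
        rw [degree_cyclotomic] at this
        have h6 : (6 : WithBot ℕ) = 1 := by exact_mod_cast this
        exact absurd h6 (by decide)
    have hch : f.charpoly = X ^ 7 - 1 := by
      rw [hq, hq1, ← hfac, mul_comm, show c = -1 by rw [← hc1, neg_neg]]
      simp [sub_eq_add_neg]
    have : Nonempty (Fin (Module.finrank K V)) := ⟨⟨0, by omega⟩⟩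
    rw [LinearMap.trace_eq_matrix_trace K (Module.finBasis K V), Matrix.trace_eq_neg_charpoly_coeff,
      LinearMap.charpoly_toMatrix, hch, Fintype.card_fin, hd]
    simp [coeff_X_pow, coeff_one]

lemma trace_involution {K : Type} [Field K] [CharZero K]
    {V : Type} [AddCommGroup V] [Module K V] [FiniteDimensional K V]
    (hd : Module.finrank K V = 7) (f : Module.End K V) (hf : f ^ 2 = 1) :
    ∃ k : ℕ, 7 + LinearMap.trace K V f = 2 * k := by
  let p : Module.End K V := (2 : K)⁻¹ • (1 + f)
  have hp : IsIdempotentElem p := by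
    have : (1 + f) * (1 + f) = (2 : K) • (1 + f) := by
      rw [mul_add, add_mul, add_mul, ← pow_two f, hf]; simp; module
    unfold IsIdempotentElem
    simp only [p, smul_mul_assoc, mul_smul_comm, this, smul_smul]
    norm_num
  refine ⟨Module.finrank K (LinearMap.range p), ?_⟩
  have h := (LinearMap.IsIdempotentElem.isProj_range p hp).trace
  rw [← h]
  simp [p, hd]
  ring

open CategoryTheory in
lemma sum_char_zero {K : Type} [Field K] [CharZero K] (V : FDRep K PSL28) (hV : Simple V)
    (hd : Module.finrank K V = 7) : ∑ g, V.character g = 0 := by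
  have hN : (Nat.card PSL28 : K) ≠ 0 := Nat.cast_ne_zero.2 Nat.card_pos.ne'
  let _ : Invertible (Nat.card PSL28 : K) := invertibleOfNonzero hN
  have h := FDRep.average_char_eq_finrank_invariants V
  have h0 : Representation.invariants V.ρ = ⊥ := by
    rw [Submodule.eq_bot_iff]
    intro v hv
    by_contra hv0
    rw [Representation.mem_invariants] at hv
    let W : FDRep K PSL28 := FDRep.of (Representation.trivial K PSL28 K)
    let f : W ⟶ V := ⟨InducedCategory.homMk (ModuleCat.ofHom (LinearMap.toSpanSingleton K V v)), by
      intro g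
      ext1
      apply LinearMap.ext
      intro c
      change c • v = V.ρ g (c • v)
      rw [map_smul, hv g]⟩
    have hinj : Function.Injective (fun c : K => c • v) := smul_left_injective K hv0
    have hm : Mono f := by
      apply (Action.forget (FGModuleCat K) PSL28).mono_of_mono_map
      apply (forget (FGModuleCat K)).mono_of_mono_map
      rw [mono_iff_injective]
      exact hinj
    have hf0 : f ≠ 0 := by
      intro h0
      have h1 : (f.hom.hom.hom : K →ₗ[K] V) (1 : K) = 0 := by rw [h0]; rfl
      have h2 : (1 : K) • v = 0 := h1
      rw [one_smul] at h2
      exact hv0 h2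
    have := (Simple.mono_isIso_iff_nonzero f).2 hf0
    have e := FDRep.isoToLinearEquiv (asIso f)
    have h17 : Module.finrank K K = Module.finrank K V := e.finrank_eq
    rw [Module.finrank_self, hd] at h17
    omega
  rw [h0, finrank_bot] at h
  simpa [hN] using h

/-! ### Class functions on `PSL(2,8)` -/

lemma sum_conj {G : Type} [Group G] [Fintype G] {K : Type} [Field K] (C : Finset G)
    (hinv : ∀ x y, y ∈ C → x * y * x⁻¹ ∈ C) (g : G)
    (hconj : ∀ y ∈ C, ∃ x, y = x * g * x⁻¹) (F : G → K) :
    (C.card : K) * ∑ x : G, F (x⁻¹ * g * x) = Fintype.card G * ∑ y ∈ C, F y := by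
  have h1 : ∀ y ∈ C, ∑ x : G, F (x⁻¹ * y * x) = ∑ x : G, F (x⁻¹ * g * x) := by
    intro y hy
    obtain ⟨z, rfl⟩ := hconj y hy
    refine Fintype.sum_equiv (Equiv.mulLeft z⁻¹) _ _ (fun x => ?_)
    simp [mul_assoc]
  have h2 : ∀ x : G, ∑ y ∈ C, F (x⁻¹ * y * x) = ∑ y ∈ C, F y := by
    intro x
    refine Finset.sum_bij' (fun y _ => x⁻¹ * y * x) (fun y _ => x * y * x⁻¹) ?_ ?_ ?_ ?_ ?_
    · intro y hy; simpa using hinv x⁻¹ y hy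
    · intro y hy; exact hinv x y hy
    · intro y hy; group
    · intro y hy; group
    · intro y hy; rfl
  calc (C.card : K) * ∑ x : G, F (x⁻¹ * g * x) = ∑ y ∈ C, ∑ x : G, F (x⁻¹ * y * x) := by
        rw [Finset.sum_congr rfl h1, Finset.sum_const, nsmul_eq_mul]
    _ = ∑ x : G, ∑ y ∈ C, F (x⁻¹ * y * x) := Finset.sum_comm
    _ = _ := by
        rw [Finset.sum_congr rfl (fun x _ => h2 x), Finset.sum_const, nsmul_eq_mul,
          Finset.card_univ]

lemma indChar_class {G : Type} [Group G] [Fintype G] {K : Type} [Field K] (H : Subgroup G)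
    (ψ : H → K) (C : Finset G)
    (hinv : ∀ x y, y ∈ C → x * y * x⁻¹ ∈ C) (g : G)
    (hconj : ∀ y ∈ C, ∃ x, y = x * g * x⁻¹) :
    (C.card : K) * indChar H ψ g = Fintype.card G * ((Fintype.card H : K)⁻¹ *
      ∑ y : H, if (y : G) ∈ C then ψ y else 0) := by
  have := sum_conj C hinv g hconj (fun y => if h : y ∈ H then ψ ⟨y, h⟩ else 0)
  unfold indChar
  rw [mul_left_comm, this, mul_left_comm]
  congr 2
  rw [← Finset.sum_filter_add_sum_filter_not C (fun y => y ∈ H)]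
  rw [Finset.sum_eq_zero (s := C.filter (fun y => ¬ y ∈ H)), add_zero]
  · rw [← Finset.sum_filter]
    symm
    refine Finset.sum_bij (fun y _ => (y : G)) ?_ ?_ ?_ ?_
    · intro y hy; simpa using hy
    · intro y _ z _ h; exact Subtype.ext h
    · intro y hy
      simp only [Finset.mem_filter] at hy
      exact ⟨⟨y, hy.2⟩, by simpa using hy.1, rfl⟩
    · intro y hy; simp
  · intro y hy
    simp only [Finset.mem_filter] at hy
    simp [hy.2]

lemma indChar_one {G : Type} [Group G] [Fintype G] {K : Type} [Field K] (H : Subgroup G)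
    (ψ : H →* K) : indChar H ψ 1 = (Fintype.card H : K)⁻¹ * Fintype.card G := by
  unfold indChar
  congr 1
  have : ∀ x : G, (if h : x⁻¹ * 1 * x ∈ H then ψ ⟨x⁻¹ * 1 * x, h⟩ else 0) = 1 := by
    intro x
    have h1 : x⁻¹ * 1 * x = 1 := by group
    rw [dif_pos (by rw [h1]; exact one_mem H)]
    rw [← map_one ψ]
    congr 1
    exact Subtype.ext h1
  rw [Finset.sum_congr rfl (fun x _ => this x)]
  simp

/-- the trace on `PSL(2,8)` -/
noncomputable def T (g : PSL28) : F8 := tr (qe.symm g)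

/-- the non-identity elements of given trace -/
noncomputable def Cl (t : F8) : Finset PSL28 := Finset.univ.filter (fun y => y ≠ 1 ∧ T y = t)

lemma T_conj (x y : PSL28) : T (x * y * x⁻¹) = T y := by
  simp only [T, map_mul, map_inv, tr_conj]

lemma T_one : T 1 = 0 := by simp only [T, map_one, tr_one]

lemma Cl_inv (t : F8) (x y : PSL28) (h : y ∈ Cl t) : x * y * x⁻¹ ∈ Cl t := by
  simp only [Cl, Finset.mem_filter, Finset.mem_univ, true_and, T_conj] at h ⊢
  exact ⟨by rw [ne_eq, conj_eq_one_iff]; exact h.1, h.2⟩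

lemma PSL_conj (g y : PSL28) (hg : g ≠ 1) (hy : y ≠ 1) (h : T y = T g) :
    ∃ x, y = x * g * x⁻¹ := by
  obtain ⟨x, hx⟩ := conj_of_tr (qe.symm g) (qe.symm y) (by simpa using hg) (by simpa using hy)
    h.symm
  refine ⟨qe x, ?_⟩
  apply qe.symm.injective
  rw [hx]; simp

lemma card_T (a : F8) (ha : a ^ 3 = a + 1) (P : M8 → Bool) (Q : F8 → Prop)
    (hPQ : ∀ x, P x = true ↔ Q (phi a x)) :
    (Finset.univ.filter (fun y : PSL28 => Q (T y))).card = cnt P := by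
  rw [← card_tr a ha P Q hPQ, ← Fintype.card_subtype, ← Nat.card_eq_fintype_card]
  refine Nat.card_congr (qe.symm.toEquiv.subtypeEquiv ?_)
  intro y; rfl

lemma card_PSL (a : F8) (ha : a ^ 3 = a + 1) : Fintype.card PSL28 = 504 := by
  have h := card_T a ha (fun _ => true) (fun _ => True) (by simp)
  rw [show cnt (fun _ => true) = 504 by decide +kernel] at h
  simpa using h

lemma card_Cl (a : F8) (ha : a ^ 3 = a + 1) (t : F8) : (Cl t).card =
    if t = 0 then 63 else if t ^ 3 + t ^ 2 + 1 = 0 then 72 else 56 := by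
  have h : (Finset.univ.filter (fun y : PSL28 => T y = t)).card =
      if t = 0 then 64 else if t ^ 3 + t ^ 2 + 1 = 0 then 72 else 56 := by
    rw [← card_tr_eq a ha t, ← Fintype.card_subtype, ← Nat.card_eq_fintype_card]
    refine Nat.card_congr (qe.symm.toEquiv.subtypeEquiv ?_)
    intro y; rfl
  have hC : Cl t = (Finset.univ.filter (fun y : PSL28 => T y = t)).erase 1 := by
    ext y; simp [Cl]
  by_cases ht : t = 0
  · rw [hC, Finset.card_erase_of_mem (by simp [T_one, ht]), h]; simp [ht]
  · rw [hC, Finset.erase_eq_of_notMem (by simp [T_one, Ne.symm ht]), h]; simp [ht]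

lemma F8_c1 : ¬ ((1 : F8) ^ 3 + 1 + 1 = 0) := by
  intro h
  exact one_ne_zero (show (1 : F8) = 0 by linear_combination h - two_F8)

lemma F8_c2 : ¬ ((1 : F8) ^ 3 + 1 ^ 2 + 1 = 0) := by
  intro h
  exact one_ne_zero (show (1 : F8) = 0 by linear_combination h - two_F8)

lemma F8_c3 (t : F8) (h : t ^ 3 + t + 1 = 0) : t ≠ 0 ∧ t ≠ 1 ∧ ¬ (t ^ 3 + t ^ 2 + 1 = 0) := by
  have h0 : t ≠ 0 := by rintro rfl; simp at h
  have h1 : t ≠ 1 := by rintro rfl; exact F8_c1 h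
  refine ⟨h0, h1, fun h2 => ?_⟩
  have : t * (t - 1) = 0 := by linear_combination h2 - h
  rcases mul_eq_zero.1 this with h | h
  · exact h0 h
  · exact h1 (sub_eq_zero.1 h)

lemma F8_c4 (t : F8) (h : t ^ 3 + t ^ 2 + 1 = 0) : t ≠ 0 ∧ t ≠ 1 ∧ ¬ (t ^ 3 + t + 1 = 0) := by
  refine ⟨?_, ?_, fun h2 => (F8_c3 t h2).2.2 h⟩
  · rintro rfl; simp at h
  · rintro rfl; exact F8_c2 h

/-! ### The character of the irreducible representation -/

lemma V_values {K : Type} [Field K] [CharZero K] (a : F8) (ha : a ^ 3 = a + 1)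
    (hirr : Irreducible (Polynomial.cyclotomic 7 K))
    (V : FDRep K PSL28) (hV : CategoryTheory.Simple V) (hdim : Module.finrank K V = 7)
    (hval3 : ∀ x : PSL28, orderOf x = 3 → V.character x = -2)
    (hval9 : ∀ x : PSL28, orderOf x = 9 → V.character x = 1) (g : PSL28) :
    V.character g = if g = 1 then 7 else if T g = 0 then -1 else if T g = 1 then -2 else
      if T g ^ 3 + T g + 1 = 0 then 1 else 0 := by
  have v1 : V.character 1 = 7 := by rw [FDRep.char_one, hdim]; norm_num
  have v3 : ∀ y, T y = 1 → V.character y = -2 := fun y hy => hval3 y (by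
    rw [← MulEquiv.orderOf_eq qe.symm]; exact order_three _ hy)
  have v9 : ∀ y, T y ^ 3 + T y + 1 = 0 → V.character y = 1 := fun y hy => hval9 y (by
    rw [← MulEquiv.orderOf_eq qe.symm]; exact order_nine _ hy)
  -- elements of order seven
  have p7 : ∀ y, T y ^ 3 + T y ^ 2 + 1 = 0 → y ^ 7 = 1 := fun y hy => by
    apply qe.symm.injective
    rw [map_pow, map_one]; exact pow_seven _ hy
  have n1 : ∀ y : PSL28, T y ^ 3 + T y ^ 2 + 1 = 0 → y ≠ 1 := by
    rintro y hy rfl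
    exact (F8_c4 _ hy).1 T_one
  have v7 : ∀ y, T y ^ 3 + T y ^ 2 + 1 = 0 → V.ρ y = 1 ∨ V.character y = 0 := fun y hy =>
    trace_order_seven hirr hdim (V.ρ y) (by rw [← map_pow, p7 y hy, map_one])
  have Tsq : ∀ y, T (y ^ 2) = T y ^ 2 := fun y => by simp only [T, map_pow, tr_sq]
  have v7' : ∃ x : K, (x = 0 ∨ x = 7) ∧ ∀ y, T y ^ 3 + T y ^ 2 + 1 = 0 → V.character y = x := by
    by_cases hex : ∃ y, T y ^ 3 + T y ^ 2 + 1 = 0 ∧ V.ρ y = 1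
    · obtain ⟨y, hy, hρ⟩ := hex
      refine ⟨7, Or.inr rfl, fun z hz => ?_⟩
      have key : ∀ u : PSL28, u ≠ 1 → V.ρ u = 1 → T z = T u → V.character z = 7 := by
        intro u hu hρu ht
        obtain ⟨x, rfl⟩ := PSL_conj u z hu (n1 z hz) ht
        rw [FDRep.char_conj, ← v1]
        unfold FDRep.character
        rw [hρu, map_one V.ρ]
      have hprod : (T z - T y) * ((T z - T y ^ 2) * (T z - (T y ^ 2) ^ 2)) = 0 := by
        have e1 : T y ^ 4 + T y ^ 2 + T y = 1 := by
          linear_combination (T y - 1) * hy + T y ^ 2 * two_F8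
        have e2 : T y ^ 6 + T y ^ 5 + T y ^ 3 = 0 := by linear_combination T y ^ 3 * hy
        have e3 : T y ^ 7 = 1 := by
          linear_combination (T y ^ 4 - T y ^ 3 + T y ^ 2 + 1) * hy -
            (T y ^ 4 + T y ^ 2 + 1) * two_F8
        linear_combination hz - T z ^ 2 * e1 + T z * e2 - e3 - (T z ^ 2 + 1) * two_F8
      have hsq : ∀ u, T u ^ 3 + T u ^ 2 + 1 = 0 → T (u ^ 2) ^ 3 + T (u ^ 2) ^ 2 + 1 = 0 := by
        intro u hu
        rw [Tsq]
        linear_combination (T u ^ 3 + T u ^ 2 + 1) * hu -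
          (T u ^ 5 + T u ^ 3 + T u ^ 2) * two_F8
      rcases mul_eq_zero.1 hprod with h | h
      · exact key y (n1 y hy) hρ (sub_eq_zero.1 h)
      · rcases mul_eq_zero.1 h with h | h
        · exact key (y ^ 2) (n1 _ (hsq y hy)) (by rw [map_pow, hρ, one_pow])
            (by rw [Tsq]; exact sub_eq_zero.1 h)
        · exact key ((y ^ 2) ^ 2) (n1 _ (hsq _ (hsq y hy))) (by simp only [map_pow, hρ, one_pow])
            (by rw [Tsq, Tsq]; exact sub_eq_zero.1 h)
    · push Not at hex
      exact ⟨0, Or.inl rfl, fun y hy => (v7 y hy).resolve_left (hex y hy)⟩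
  obtain ⟨x, hx, v7x⟩ := v7'
  -- involutions
  have hne : (Cl 0).Nonempty := by
    rw [← Finset.card_pos, card_Cl a ha]; simp
  obtain ⟨i, hi⟩ := hne
  simp only [Cl, Finset.mem_filter, Finset.mem_univ, true_and] at hi
  have v2 : ∀ y, y ≠ 1 → T y = 0 → V.character y = V.character i := by
    intro y hy ht
    obtain ⟨x, rfl⟩ := PSL_conj i y hi.1 hy (by rw [ht, hi.2])
    rw [FDRep.char_conj]
  obtain ⟨k, hk⟩ := trace_involution hdim (V.ρ i) (by
    rw [← map_pow, show i ^ 2 = 1 from by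
      apply qe.symm.injective
      rw [map_pow, map_one]; exact SL_sq_eq_one _ hi.2, map_one])
  change 7 + V.character i = 2 * k at hk
  set w := V.character i with hw
  -- the sum
  have hsum := sum_char_zero V hV hdim
  have hpt : ∀ y, V.character y = (if T y = 0 then w else 0) + (if T y = 1 then -2 else 0) +
      (if T y ^ 3 + T y + 1 = 0 then 1 else 0) + (if T y ^ 3 + T y ^ 2 + 1 = 0 then x else 0) +
      (if y = 1 then 7 - w else 0) := by
    intro y
    by_cases hy : y = 1
    · subst hy; simp [v1, T_one]
    · rcases F8_cases (T y) with h | h | h | h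
      · rw [v2 y hy h]; simp [h, hy]
      · rw [v3 y h, h]; simp only [F8_c1, F8_c2, hy]; simp
      · rw [v9 y h]; obtain ⟨h1, h2, h3⟩ := F8_c3 _ h; simp [h, h1, h2, h3, hy]
      · rw [v7x y h]; obtain ⟨h1, h2, h3⟩ := F8_c4 _ h; simp [h, h1, h2, h3, hy]
  have c0 := card_T a ha (fun m => m == 0) (fun t => t = 0) (fun m => by
    rw [← phi_zero a, (phi_inj a ha).eq_iff]; simp)
  have c1 := card_T a ha (fun m => m == (1, 0, 0)) (fun t => t = 1) (fun m => by
    rw [← phi_one a, (phi_inj a ha).eq_iff]; simp)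
  have c9 := card_T a ha (fun m => cubeM m + m + (1, 0, 0) == 0) (fun t => t ^ 3 + t + 1 = 0)
    (fun m => by
      rw [beq_iff_eq, ← (phi_inj a ha).eq_iff, phi_add, phi_add, phi_cube a ha, phi_one, phi_zero])
  have c7 := card_T a ha (fun m => cubeM m + mulM m m + (1, 0, 0) == 0)
    (fun t => t ^ 3 + t ^ 2 + 1 = 0) (fun m => by
      rw [beq_iff_eq, ← (phi_inj a ha).eq_iff, phi_add, phi_add, phi_cube a ha, phi_mul a ha,
        phi_one, phi_zero, sq])
  rw [show cnt (fun m => m == 0) = 64 by decide +kernel] at c0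
  rw [show cnt (fun m => m == (1, 0, 0)) = 56 by decide +kernel] at c1
  rw [show cnt (fun m => cubeM m + m + (1, 0, 0) == 0) = 168 by decide +kernel] at c9
  rw [show cnt (fun m => cubeM m + mulM m m + (1, 0, 0) == 0) = 216 by decide +kernel] at c7
  rw [Finset.sum_congr rfl (fun y _ => hpt y)] at hsum
  simp only [Finset.sum_add_distrib, ← Finset.sum_filter, Finset.sum_const, c0, c1, c9, c7,
    nsmul_eq_mul, Finset.filter_eq', Finset.mem_univ, if_true, Finset.card_singleton] at hsum
  push_cast at hsum
  have hx0 : x = 0 := by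
    rcases hx with h | h
    · exact h
    · exfalso
      rw [h] at hsum
      have hw' : w = -25 := by linear_combination hsum / 63
      have : ((2 * k + 18 : ℕ) : K) = 0 := by push_cast; linear_combination hw' - hk
      exact absurd (Nat.cast_eq_zero.1 this) (by omega)
  have hw1 : w = -1 := by rw [hx0] at hsum; linear_combination hsum / 63
  by_cases hy : g = 1
  · subst hy; simp [v1]
  · rcases F8_cases (T g) with h | h | h | h
    · rw [v2 g hy h]; simp [h, hy, hw1]
    · rw [v3 g h, h]; simp [hy]
    · rw [v9 g h]; obtain ⟨h1, h2, h3⟩ := F8_c3 _ h; simp [h, h1, h2, hy]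
    · rw [v7x g h]; obtain ⟨h1, h2, h3⟩ := F8_c4 _ h; simp [h1, h2, h3, hy, hx0]

/-! ### The two induced characters -/

lemma indChar_Cl {K : Type} [Field K] [CharZero K] (a : F8) (ha : a ^ 3 = a + 1)
    (H : Subgroup PSL28) (ψ : H → K) (g : PSL28) (hg : g ≠ 1) :
    ((Cl (T g)).card : K) * indChar H ψ g = 504 * ((Nat.card H : K)⁻¹ *
      ∑ y : H, if (y : PSL28) ∈ Cl (T g) then ψ y else 0) := by
  have h := indChar_class H ψ (Cl (T g)) (Cl_inv _) g (fun y hy => by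
    simp only [Cl, Finset.mem_filter, Finset.mem_univ, true_and] at hy
    exact PSL_conj g y hg hy.1 hy.2)
  rw [card_PSL a ha, ← Nat.card_eq_fintype_card (α := H)] at h
  exact_mod_cast h

lemma ind_chi {K : Type} [Field K] [CharZero K] (a : F8) (ha : a ^ 3 = a + 1)
    (H : Subgroup PSL28) (hcard : Nat.card H = 8) (hT : ∀ y ∈ H, T y = 0) (χ : H →* K)
    (s : H) (hs : χ s = -1) (g : PSL28) :
    indChar H χ g = if g = 1 then 63 else if T g = 0 then -1 else 0 := by
  by_cases hg : g = 1
  · subst hg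
    rw [indChar_one, card_PSL a ha, ← Nat.card_eq_fintype_card, hcard, if_pos rfl]
    norm_num
  have h := indChar_Cl a ha H χ g hg
  rw [if_neg hg]
  rw [hcard] at h
  by_cases h0 : T g = 0
  · rw [if_pos h0]
    have hsum : ∑ y : H, χ y = 0 := by
      have h1 : ∑ y : H, χ (s * y) = ∑ y : H, χ y :=
        Fintype.sum_equiv (Equiv.mulLeft s) _ _ (fun y => rfl)
      simp only [map_mul, hs, ← Finset.mul_sum] at h1
      have : (2 : K) * ∑ y : H, χ y = 0 := by linear_combination -h1
      simpa using this
    have hS : ∑ y : H, (if (y : PSL28) ∈ Cl (T g) then χ y else 0) = -1 := by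
      have : ∀ y : H, (if (y : PSL28) ∈ Cl (T g) then χ y else 0) =
          χ y - if y = 1 then 1 else 0 := by
        intro y
        by_cases hy : y = 1
        · subst hy; simp [Cl]
        · have : (y : PSL28) ∈ Cl (T g) := by
            simp only [Cl, Finset.mem_filter, Finset.mem_univ, true_and]
            exact ⟨by simpa using hy, by rw [hT _ y.2, h0]⟩
          simp [this, hy]
      rw [Finset.sum_congr rfl (fun y _ => this y), Finset.sum_sub_distrib, hsum]
      simp
    rw [hS, h0, card_Cl a ha, if_pos rfl] at h
    push_cast at h
    linear_combination h / 63
  · rw [if_neg h0]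
    have hS : ∑ y : H, (if (y : PSL28) ∈ Cl (T g) then χ y else 0) = 0 := by
      apply Finset.sum_eq_zero
      intro y _
      rw [if_neg]
      simp only [Cl, Finset.mem_filter, Finset.mem_univ, true_and, not_and]
      intro _ h1
      exact h0 (by rw [← h1, hT _ y.2])
    rw [hS, card_Cl a ha, if_neg h0] at h
    split_ifs at h <;> simpa using h

lemma sum_zpowers {G : Type} [Group G] [Fintype G] {K : Type} [Field K] (x : G)
    (f : Subgroup.zpowers x → K) : ∑ y, f y =
      ∑ n ∈ Finset.range (orderOf x), f ⟨x ^ n, Subgroup.npow_mem_zpowers x n⟩ := by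
  rw [← Fin.sum_univ_eq_sum_range
    (fun n => f ⟨x ^ n, Subgroup.npow_mem_zpowers x n⟩)]
  symm
  exact Fintype.sum_equiv (finEquivZPowers (isOfFinOrder_of_finite x)) _ _ (fun n => rfl)

lemma ind_rho {K : Type} [Field K] [CharZero K] (ζ : K) (hζ : IsPrimitiveRoot ζ 3)
    (a : F8) (ha : a ^ 3 = a + 1) (h : PSL28) (hh : T h = a ^ 4)
    (ρ : Subgroup.zpowers h →* K) (hρ : ρ ⟨h, Subgroup.mem_zpowers _⟩ = ζ ^ 2) (g : PSL28) :
    indChar (Subgroup.zpowers h) ρ g = if g = 1 then 56 else if T g = 1 then 2 else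
      if T g ^ 3 + T g + 1 = 0 then -1 else 0 := by
  have hz3 : ζ ^ 3 = 1 := hζ.pow_eq_one
  have hz : ζ ^ 2 + ζ + 1 = 0 := by
    have h1 : (ζ - 1) * (ζ ^ 2 + ζ + 1) = 0 := by linear_combination hz3
    exact (mul_eq_zero.1 h1).resolve_left (sub_ne_zero.2 (hζ.ne_one (by norm_num)))
  have hord : orderOf h = 9 := by
    rw [← MulEquiv.orderOf_eq qe.symm]
    apply order_nine
    change T h ^ 3 + T h + 1 = 0
    rw [hh]
    (have h2 := two_F8; grind)
  have hcard : Nat.card (Subgroup.zpowers h) = 9 := by rw [Nat.card_zpowers, hord]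
  by_cases hg : g = 1
  · subst hg
    rw [indChar_one, card_PSL a ha, ← Nat.card_eq_fintype_card, hcard, if_pos rfl]
    norm_num
  have hi := indChar_Cl a ha _ ρ g hg
  rw [if_neg hg]
  rw [hcard, sum_zpowers, hord] at hi
  have hne : ∀ n, 0 < n → n < 9 → h ^ n ≠ 1 := fun n h0 h9 =>
    pow_ne_one_of_lt_orderOf h0.ne' (by rw [hord]; exact h9)
  have hρn : ∀ n, ρ ⟨h ^ n, Subgroup.npow_mem_zpowers h n⟩ = ζ ^ (2 * n) := by
    intro n
    rw [pow_mul, ← hρ, ← map_pow]; rfl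
  have Trec : ∀ n, T (h ^ (n + 2)) = a ^ 4 * T (h ^ (n + 1)) + T (h ^ n) := by
    intro n; rw [← hh]; simp only [T, map_pow, tr_rec]
  have t0 : T (h ^ 0) = 0 := by rw [pow_zero, T_one]
  have t1 : T (h ^ 1) = a ^ 4 := by rw [pow_one, hh]
  have a4 : a ^ 4 = a ^ 2 + a := by linear_combination a * ha
  have t2 : T (h ^ 2) = a := by
    rw [Trec 0, t1, t0]; (have h2 := two_F8; grind)
  have t3 : T (h ^ 3) = 1 := by
    rw [Trec 1, t1, t2]; (have h2 := two_F8; grind)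
  have t4 : T (h ^ 4) = a ^ 2 := by
    rw [Trec 2, t2, t3]; (have h2 := two_F8; grind)
  have t5 : T (h ^ 5) = a ^ 2 := by
    rw [Trec 3, t3, t4]; (have h2 := two_F8; grind)
  have t6 : T (h ^ 6) = 1 := by
    rw [Trec 4, t4, t5]; (have h2 := two_F8; grind)
  have t7 : T (h ^ 7) = a := by
    rw [Trec 5, t5, t6]; (have h2 := two_F8; grind)
  have t8 : T (h ^ 8) = a ^ 4 := by
    rw [Trec 6, t6, t7]; (have h2 := two_F8; grind)
  have hmem : ∀ n, 0 < n → n < 9 → (h ^ n ∈ Cl (T g) ↔ T (h ^ n) = T g) := by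
    intro n h0 h9
    simp only [Cl, Finset.mem_filter, Finset.mem_univ, true_and, hne n h0 h9, ne_eq,
      not_false_eq_true]
  have hmem0 : h ^ 0 ∉ Cl (T g) := by simp [Cl]
  simp only [Finset.sum_range_succ, Finset.sum_range_zero, hρn, if_neg hmem0] at hi
  simp only [hmem 1 (by norm_num) (by norm_num), hmem 2 (by norm_num) (by norm_num),
    hmem 3 (by norm_num) (by norm_num), hmem 4 (by norm_num) (by norm_num),
    hmem 5 (by norm_num) (by norm_num), hmem 6 (by norm_num) (by norm_num),
    hmem 7 (by norm_num) (by norm_num), hmem 8 (by norm_num) (by norm_num),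
    t1, t2, t3, t4, t5, t6, t7, t8, card_Cl a ha] at hi
  have na0 : a ≠ 0 := by rintro rfl; simp at ha
  have na1 : a ≠ 1 := by
    rintro rfl
    exact one_ne_zero (show (1 : F8) = 0 by linear_combination -ha)
  have na2 : a ^ 2 ≠ 1 := by
    intro h2
    have : (a - 1) ^ 2 = 0 := by linear_combination h2 - (a - 1) * two_F8
    exact na1 (sub_eq_zero.1 (pow_eq_zero_iff two_ne_zero |>.1 this))
  have na4 : a ^ 4 ≠ 1 := by
    intro h2
    have : (a ^ 2 - 1) ^ 2 = 0 := by linear_combination h2 - (a ^ 2 - 1) * two_F8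
    exact na2 (sub_eq_zero.1 (pow_eq_zero_iff two_ne_zero |>.1 this))
  have n21 : a ^ 2 ≠ a := by
    intro h2
    have : a * (a - 1) = 0 := by linear_combination h2
    rcases mul_eq_zero.1 this with h | h
    · exact na0 h
    · exact na1 (sub_eq_zero.1 h)
  have n41 : a ^ 4 ≠ a := by
    intro h2
    have : a ^ 2 = 0 := by linear_combination h2 - a4
    exact na0 (pow_eq_zero_iff two_ne_zero |>.1 this)
  have n42 : a ^ 4 ≠ a ^ 2 := by
    intro h2
    exact na0 (by linear_combination h2 - a4)
  have ra1 : a ^ 3 + a + 1 = 0 := by linear_combination ha + (a + 1) * two_F8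
  have ra2 : (a ^ 2) ^ 3 + a ^ 2 + 1 = 0 := by
    linear_combination (a ^ 3 + a + 1) * ra1 - (a ^ 4 + a ^ 3 + a) * two_F8
  have ra4 : (a ^ 4) ^ 3 + a ^ 4 + 1 = 0 := by
    linear_combination ((a ^ 2) ^ 3 + a ^ 2 + 1) * ra2 - (a ^ 8 + a ^ 6 + a ^ 2) * two_F8
  by_cases h1 : T g = 1
  · rw [h1] at hi ⊢
    simp only [na1, na2, na4, F8_c2, one_ne_zero, if_false, if_true] at hi ⊢
    push_cast at hi
    have e6 : ζ ^ (2 * 3) = 1 := by rw [mul_comm, pow_mul, hz3, one_pow]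
    have e12 : ζ ^ (2 * 6) = 1 := by
      rw [show 2 * 6 = 3 * 4 from rfl, pow_mul, hz3, one_pow]
    rw [e6, e12] at hi
    linear_combination hi / 56
  rw [if_neg h1]
  by_cases h9 : T g ^ 3 + T g + 1 = 0
  · obtain ⟨q0, q1, q7⟩ := F8_c3 _ h9
    rw [if_neg q0, if_neg q7] at hi
    rw [if_pos h9]
    have hprod : (T g - a) * ((T g - a ^ 2) * (T g - a ^ 4)) = 0 := by
      (have h2 := two_F8; grind)
    push_cast at hi
    have e2 : ζ ^ (2 * 1) + ζ ^ (2 * 8) = -1 := by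
      linear_combination hz + (ζ ^ 13 + ζ ^ 10 + ζ ^ 7 + ζ ^ 4 + ζ) * hz3
    have e4 : ζ ^ (2 * 2) + ζ ^ (2 * 7) = -1 := by
      linear_combination hz + (ζ ^ 11 + ζ ^ 8 + ζ ^ 5 + ζ ^ 2 + ζ) * hz3
    have e8 : ζ ^ (2 * 4) + ζ ^ (2 * 5) = -1 := by
      linear_combination hz + (ζ ^ 7 + ζ ^ 4 + ζ + ζ ^ 5 + ζ ^ 2) * hz3
    rcases mul_eq_zero.1 hprod with e | e
    · rw [sub_eq_zero.1 e] at hi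
      simp only [n21, n41, Ne.symm na1, if_true, if_false] at hi
      linear_combination hi / 56 + e4
    · rcases mul_eq_zero.1 e with e | e
      · rw [sub_eq_zero.1 e] at hi
        simp only [n21.symm, n42, Ne.symm na2, if_true, if_false] at hi
        linear_combination hi / 56 + e8
      · rw [sub_eq_zero.1 e] at hi
        simp only [n41.symm, n42.symm, Ne.symm na4, if_true, if_false] at hi
        linear_combination hi / 56 + e2
  · rw [if_neg h9]
    have m1 : a ≠ T g := by intro e; rw [← e] at h9; exact h9 ra1
    have m2 : a ^ 2 ≠ T g := by intro e; rw [← e] at h9; exact h9 ra2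
    have m4 : a ^ 4 ≠ T g := by intro e; rw [← e] at h9; exact h9 ra4
    simp only [m1, m2, m4, Ne.symm h1, if_false, add_zero, mul_zero] at hi
    split_ifs at hi <;> simpa using hi

lemma closure_T (s t u : SL28) (hs : s ^ 2 = 1) (ht : t ^ 2 = 1) (hu : u ^ 2 = 1)
    (hst : s * t = t * s) (hsu : s * u = u * s) (htu : t * u = u * t) (y : PSL28)
    (hy : y ∈ (Subgroup.closure {QuotientGroup.mk s, QuotientGroup.mk t, QuotientGroup.mk u} :
      Subgroup PSL28)) : T y = 0 := by
  set S : Set PSL28 := {qe s, qe t, qe u} with hS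
  have hyS : y ∈ Subgroup.closure S := hy
  have hcomm : ∀ x ∈ S, ∀ z ∈ S, x * z = z * x := by
    rintro x (rfl | rfl | rfl) z (rfl | rfl | rfl) <;>
      simp only [← map_mul, hst, hsu, htu]
  have hsq : ∀ x ∈ S, x ^ 2 = 1 := by
    rintro x (rfl | rfl | rfl) <;> simp only [← map_pow, hs, ht, hu, map_one]
  have hcl := Subgroup.isMulCommutative_closure hcomm
  have key : y ^ 2 = 1 := by
    induction hyS using Subgroup.closure_induction with
    | mem x hx => exact hsq x hx
    | one => simp
    | mul x z hx hz ihx ihz =>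
      have hc : Commute x z := by
        have := hcl.is_comm.comm (⟨x, hx⟩ : Subgroup.closure S) ⟨z, hz⟩
        exact congrArg Subtype.val this
      rw [hc.mul_pow, ihx (by exact hx), ihz (by exact hz), one_mul]
    | inv x hx ih => rw [inv_pow, ih (by exact hx), inv_one]
  apply tr_eq_zero
  rw [← map_pow, key, map_one]

theorem stmt17
    (K : Type) [Field K] [Algebra ℚ K] [IsCyclotomicExtension {3} ℚ K]
    (ζ : K) (hζ : IsPrimitiveRoot ζ 3)
    -- a generator `a` of 𝔽₈ with a³ = a + 1
    (a : F8) (ha : a ^ 3 = a + 1)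
    -- the matrices s, t, u, h (as elements of SL(2,8), taken modulo scalars below)
    (s t u h : SL28)
    (hs : (s : Matrix (Fin 2) (Fin 2) F8) = !![0, a ^ 5; a ^ 2, 0])
    (ht : (t : Matrix (Fin 2) (Fin 2) F8) = !![a ^ 5, a ^ 2; a ^ 6, a ^ 5])
    (hu : (u : Matrix (Fin 2) (Fin 2) F8) = !![a, a; a ^ 5, a])
    (hh : (h : Matrix (Fin 2) (Fin 2) F8) = !![a ^ 4, 1; 1, 0])
    -- C₂³ = ⟨s, t, u⟩, elementary abelian of order 8
    (hcard : Nat.card (Subgroup.closure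
      {QuotientGroup.mk s, QuotientGroup.mk t, QuotientGroup.mk u} : Subgroup PSL28) = 8)
    -- χ : the degree-1 character of C₂³ with χ(s) = −1, χ(t) = χ(u) = 1
    (χ : (Subgroup.closure {QuotientGroup.mk s, QuotientGroup.mk t, QuotientGroup.mk u} :
      Subgroup PSL28) →* K)
    (hχs : χ ⟨QuotientGroup.mk s, Subgroup.subset_closure (Set.mem_insert _ _)⟩ = -1)
    (hχt : χ ⟨QuotientGroup.mk t, Subgroup.subset_closure
      (Set.mem_insert_of_mem _ (Set.mem_insert _ _))⟩ = 1)
    (hχu : χ ⟨QuotientGroup.mk u, Subgroup.subset_closure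
      (Set.mem_insert_of_mem _ (Set.mem_insert_of_mem _ rfl))⟩ = 1)
    -- ρ : the degree-1 character of C₉ = ⟨h⟩ with ρ(h) = ζ₃²
    (ρ : (Subgroup.zpowers (QuotientGroup.mk h : PSL28)) →* K)
    (hρ : ρ ⟨QuotientGroup.mk h, Subgroup.mem_zpowers _⟩ = ζ ^ 2)
    -- χ₂ : the irreducible degree-7 character of PSL(2,8) with value −2 on elements of
    -- order 3 and value 1 on all elements of order 9
    (V : FDRep K PSL28) (hV : CategoryTheory.Simple V) (hdim : Module.finrank K V = 7)
    (hval3 : ∀ x : PSL28, orderOf x = 3 → V.character x = -2)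
    (hval9 : ∀ x : PSL28, orderOf x = 9 → V.character x = 1) :
    ∀ g : PSL28, indChar (Subgroup.closure
        {QuotientGroup.mk s, QuotientGroup.mk t, QuotientGroup.mk u}) χ g -
      indChar (Subgroup.zpowers (QuotientGroup.mk h : PSL28)) ρ g = V.character g := by
  have : CharZero K := algebraRat.charZero K
  have a4 : a ^ 4 = a ^ 2 + a := by linear_combination a * ha
  have a5 : a ^ 5 = a ^ 2 + a + 1 := by linear_combination (a ^ 2 + 1) * ha
  have a6 : a ^ 6 = a ^ 2 + 1 := by
    linear_combination (a ^ 3 + a + 1) * ha + a * two_F8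
  have hinv : ∀ x : SL28, x.1 0 0 = x.1 1 1 → x ^ 2 = 1 := by
    intro x hx
    apply SL_sq_eq_one
    unfold tr
    rw [hx]; linear_combination x.1 1 1 * two_F8
  have hcom : ∀ x y : SL28, x.1 0 0 = x.1 1 1 → y.1 0 0 = y.1 1 1 →
      x.1 0 1 * y.1 1 0 = y.1 0 1 * x.1 1 0 → x * y = y * x := by
    intro x y hx hy h
    apply Subtype.ext
    ext i j
    fin_cases i <;> fin_cases j <;> simp [Matrix.mul_apply, Fin.sum_univ_two]
    · linear_combination h
    · rw [hx, hy]; ring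
    · rw [hx, hy]; ring
    · linear_combination -h
  have hT := closure_T s t u (hinv s (by simp [hs])) (hinv t (by simp [ht])) (hinv u (by simp [hu]))
    (hcom s t (by simp [hs]) (by simp [ht]) (by
      simp only [hs, ht]; simp
      (have h2 := two_F8; grind)))
    (hcom s u (by simp [hs]) (by simp [hu]) (by
      simp only [hs, hu]; simp
      (have h2 := two_F8; grind)))
    (hcom t u (by simp [ht]) (by simp [hu]) (by
      simp only [ht, hu]; simp
      (have h2 := two_F8; grind)))
  have hTh : T (QuotientGroup.mk h) = a ^ 4 := by
    rw [← qe_apply, T, MulEquiv.symm_apply_apply, tr, hh]; simp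
  intro g
  rw [V_values a ha (cyclotomic_seven_irreducible K) V hV hdim hval3 hval9 g,
    ind_chi a ha _ hcard hT χ _ hχs g, ind_rho ζ hζ a ha _ hTh ρ hρ g]
  by_cases hg : g = 1
  · simp only [hg, if_true]; norm_num
  simp only [hg, if_false]
  rcases F8_cases (T g) with e | e | e | e
  · simp [e]
  · simp [e]
  · obtain ⟨e1, e2, e3⟩ := F8_c3 _ e
    simp [e, e1, e2]
  · obtain ⟨e1, e2, e3⟩ := F8_c4 _ e
    simp [e1, e2, e3]
end
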